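/- There exists a polynomial poly_1 such that for every 1-VASS with disequality tests V=(Q,D,Δ,w) (with single disequality guards), the sequence (U_n)_{n∈ℕ} stabilizes within poly_1(|Q|) steps; that is, U_n = U_{poly_1(|Q|)} for all n ≥ poly_1(|Q|). -/

import Mathlib

namespace VASSPaper

/-- A 1-VASS with disequality tests: states `Q`, transition relation `delta`,
integer weights `w`, and for each state a cofinite set `D q ⊆ ℕ` of allowed counter values. -/
structure OneVASS (Q : Type) where
  delta : Q → Q → Prop
  w : Q → Q → ℤ
  D : Q → Set ℕ
  cofinite : ∀ q, (D q)ᶜ.Finite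

variable {Q : Type}

/-- A path is a nonempty sequence of states joined by transitions. -/
def IsPath (V : OneVASS Q) : List Q → Prop
  | [] => False
  | [_] => True
  | a :: b :: l => V.delta a b ∧ IsPath V (b :: l)

/-- The weight of a path: the sum of the weights of its transitions. -/
def pathWeight (V : OneVASS Q) (π : List Q) : ℤ :=
  (List.zipWith V.w π π.tail).sum

/-- The counter value at position `i` of the run over `π` starting with counter `z`. -/
def counterAt (V : OneVASS Q) (z : ℕ) (π : List Q) (i : ℕ) : ℤ :=
  (z : ℤ) + pathWeight V (π.take (i + 1))

/-- `π` lifts to a run from counter value `z`: all counter values stay nonnegative. -/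
def IsRun (V : OneVASS Q) (π : List Q) (z : ℕ) : Prop :=
  IsPath V π ∧ ∀ i, i < π.length → 0 ≤ counterAt V z π i

/-- A valid run additionally respects all disequality guards. -/
def IsValidRun (V : OneVASS Q) (π : List Q) (z : ℕ) : Prop :=
  IsRun V π z ∧ ∀ i, ∀ h : i < π.length, (counterAt V z π i).toNat ∈ V.D (π.get ⟨i, h⟩)

/-- `π` goes from configuration `c` to configuration `c'`. -/
def RunFromTo (V : OneVASS Q) (π : List Q) (c c' : Q × ℕ) : Prop :=
  π.head? = some c.1 ∧ π.getLast? = some c'.1 ∧ (c'.2 : ℤ) = (c.2 : ℤ) + pathWeight V π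

/-- `c'` is reachable from `c` by a valid run. -/
def Reaches (V : OneVASS Q) (c c' : Q × ℕ) : Prop :=
  ∃ π, IsValidRun V π c.2 ∧ RunFromTo V π c c'

/-- A configuration is unbounded if infinitely many configurations are reachable from it. -/
def Unbounded (V : OneVASS Q) (c : Q × ℕ) : Prop :=
  {c' | Reaches V c c'}.Infinite

/-- `(s,0)` covers the state `t`. -/
def Covers (V : OneVASS Q) (s t : Q) : Prop :=
  ∃ z, Reaches V (s, 0) (t, z)

/-- Every state has at most one disequality guard. -/
def SingleGuard (V : OneVASS Q) : Prop :=
  ∀ q, V.D q = Set.univ ∨ ∃ g : ℕ, V.D q = {g}ᶜ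

/-- The minimum weight of a (possibly empty) prefix of `π`. -/
def pmin (V : OneVASS Q) (π : List Q) : ℤ :=
  ((List.range (π.length + 1)).map fun i => pathWeight V (π.take i)).foldr min 0

/-- The maximum weight of a (possibly empty) suffix of `π`. -/
def smax (V : OneVASS Q) (π : List Q) : ℤ :=
  ((List.range (π.length + 1)).map fun i => pathWeight V (π.drop i)).foldr max 0

/-- A cycle on `q`: a path with at least one transition starting and ending at `q`. -/
def IsCycleOn (V : OneVASS Q) (π : List Q) (q : Q) : Prop :=
  IsPath V π ∧ 2 ≤ π.length ∧ π.head? = some q ∧ π.getLast? = some q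

/-- A simple cycle on `q`. -/
def IsSimpleCycleOn (V : OneVASS Q) (π : List Q) (q : Q) : Prop :=
  IsCycleOn V π q ∧ π.dropLast.Nodup

/-- The set of states lying on a positive-weight simple cycle. -/
def Qplus (V : OneVASS Q) : Set Q :=
  {q | ∃ π, IsSimpleCycleOn V π q ∧ 0 < pathWeight V π}

/-- `γ` is a valid choice of cycles: for each `q ∈ Q₊`, `γ q` is a simple positive cycle
on `q` whose `pmin` is maximal among all positive-weight simple cycles on `q`. -/
def GammaChoice (V : OneVASS Q) (γ : Q → List Q) : Prop :=
  ∀ q ∈ Qplus V,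
    IsSimpleCycleOn V (γ q) q ∧ 0 < pathWeight V (γ q) ∧
      ∀ π, IsSimpleCycleOn V π q → 0 < pathWeight V π → pmin V π ≤ pmin V (γ q)

/-- `Conf₊`: configurations `(q,z)` with `q ∈ Q₊` and `z + pmin (γ q) ≥ 0`. -/
def ConfPlus (V : OneVASS Q) (γ : Q → List Q) : Set (Q × ℕ) :=
  {c | c.1 ∈ Qplus V ∧ 0 ≤ (c.2 : ℤ) + pmin V (γ c.1)}

/-- `W_q`, the weight of the chosen cycle `γ q`, as a natural number. -/
def Wnat (V : OneVASS Q) (γ : Q → List Q) (q : Q) : ℕ :=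
  (pathWeight V (γ q)).toNat

/-- The `q`-residue class of `r` modulo `W_q`. -/
def resClass (V : OneVASS Q) (γ : Q → List Q) (q : Q) (r : ℕ) : Set (Q × ℕ) :=
  {c | c ∈ ConfPlus V γ ∧ c.1 = q ∧ c.2 % Wnat V γ q = r}

/-- `iterCycle π k` is the cycle `π` iterated `k+1` times. -/
def iterCycle (π : List Q) : ℕ → List Q
  | 0 => π
  | k + 1 => iterCycle π k ++ π.tail

/-- Counter values `z < z'` at state `q` are connected by a valid run iterating `γ q`. -/
def chainLinked (V : OneVASS Q) (γ : Q → List Q) (q : Q) (z z' : ℕ) : Prop :=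
  ∃ k, IsValidRun V (iterCycle (γ q) k) z ∧
    (z' : ℤ) = (z : ℤ) + pathWeight V (iterCycle (γ q) k)

/-- Any two configurations of `S` are connected by iterating `γ q`. -/
def ChainCond (V : OneVASS Q) (γ : Q → List Q) (q : Q) (S : Set (Q × ℕ)) : Prop :=
  ∀ c ∈ S, ∀ c' ∈ S, c.2 < c'.2 → chainLinked V γ q c.2 c'.2

/-- A `q`-chain inside the `q`-residue class of `r`: a maximal subset whose
configurations are pairwise connected by iterating `γ q`. -/
def IsChainIn (V : OneVASS Q) (γ : Q → List Q) (q : Q) (r : ℕ) (C : Set (Q × ℕ)) : Prop :=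
  C ⊆ resClass V γ q r ∧ ChainCond V γ q C ∧
    ∀ C', C ⊆ C' → C' ⊆ resClass V γ q r → ChainCond V γ q C' → C' = C

/-- A chain (in some residue class of some state of `Q₊`). -/
def IsChain (V : OneVASS Q) (γ : Q → List Q) (C : Set (Q × ℕ)) : Prop :=
  ∃ q r, q ∈ Qplus V ∧ r < Wnat V γ q ∧ IsChainIn V γ q r C

/-- A set of configurations is bounded if its counter values are bounded. -/
def chainBounded (C : Set (Q × ℕ)) : Prop :=
  BddAbove (Prod.snd '' C)

/-- A residue class is trivial if it consists of a single unbounded chain. -/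
def TrivialClass (V : OneVASS Q) (γ : Q → List Q) (q : Q) (r : ℕ) : Prop :=
  IsChainIn V γ q r (resClass V γ q r) ∧ ¬ chainBounded (resClass V γ q r)

/-- There is a valid run of length `k` (i.e. `k` transitions) from `c` into the set `S`. -/
def RunLenTo (V : OneVASS Q) (c : Q × ℕ) (S : Set (Q × ℕ)) (k : ℕ) : Prop :=
  ∃ π c', c' ∈ S ∧ IsValidRun V π c.2 ∧ RunFromTo V π c c' ∧ π.length = k + 1

/-- Configurations of `Conf₊ \ Un` whose distance to `Un` is minimal among all
configurations of `Conf₊ \ Un`. -/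
def Uprime (V : OneVASS Q) (γ : Q → List Q) (Un : Set (Q × ℕ)) : Set (Q × ℕ) :=
  {c | c ∈ ConfPlus V γ \ Un ∧
    ∃ k, RunLenTo V c Un k ∧
      ∀ c' ∈ ConfPlus V γ \ Un, ∀ j, RunLenTo V c' Un j → k ≤ j}

/-- `S` is downward closed in every chain. -/
def dcClosed (V : OneVASS Q) (γ : Q → List Q) (S : Set (Q × ℕ)) : Prop :=
  ∀ C, IsChain V γ C → ∀ c ∈ S ∩ C, ∀ c' ∈ C, c'.2 ≤ c.2 → c' ∈ S

/-- The inductive sequence `U_n`: `U_0` is the union of the unbounded chains; `U_{n+1}` is the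
smallest superset of `U_n ∪ U'_n` that is downward closed in every chain. -/
def U (V : OneVASS Q) (γ : Q → List Q) : ℕ → Set (Q × ℕ)
  | 0 => ⋃₀ {C | IsChain V γ C ∧ ¬ chainBounded C}
  | n + 1 => ⋂₀ {S | U V γ n ∪ Uprime V γ (U V γ n) ⊆ S ∧ dcClosed V γ S}

/-- `C` is an `n`-active bounded chain in the `q`-residue class of `r`. -/
def nActiveIn (V : OneVASS Q) (γ : Q → List Q) (q : Q) (r : ℕ) (n : ℕ)
    (C : Set (Q × ℕ)) : Prop :=
  IsChainIn V γ q r C ∧ chainBounded C ∧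
    ∃ c ∈ U V γ n ∩ resClass V γ q r, ∃ c' ∈ C, c.2 ≤ c'.2

/-- `δ_n(C)` for a `q`-chain `C`: configurations outside `U_n` whose counter value lies
between two counter values of `C \ U_n`. -/
def deltaC (V : OneVASS Q) (γ : Q → List Q) (n : ℕ) (q : Q) (C : Set (Q × ℕ)) :
    Set (Q × ℕ) :=
  {c | c ∈ ConfPlus V γ ∧ c.1 = q ∧ c ∉ U V γ n ∧
    ∃ z₁ z₂, (q, z₁) ∈ C \ U V γ n ∧ (q, z₂) ∈ C \ U V γ n ∧ z₁ ≤ c.2 ∧ c.2 ≤ z₂}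

/-- `δ_n(R)` for the `q`-residue class `R` of `r`: union of `δ_n(C)` over `n`-active chains. -/
def deltaR (V : OneVASS Q) (γ : Q → List Q) (n : ℕ) (q : Q) (r : ℕ) : Set (Q × ℕ) :=
  {c | ∃ C, nActiveIn V γ q r n C ∧ c ∈ deltaC V γ n q C}

/-- A positive-weight cycle (as a list of states). -/
def IsPosCycle (V : OneVASS Q) (π : List Q) : Prop :=
  2 ≤ π.length ∧ π.head? = π.getLast? ∧ 0 < pathWeight V π

/-- A path is primitive if no proper infix of it is a positive-weight cycle. -/
def Primitive (V : OneVASS Q) (π : List Q) : Prop :=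
  ∀ i l, (π.drop i).take l ≠ π → ¬ IsPosCycle V ((π.drop i).take l)

/-! ### Paths as functions on an initial segment of `ℕ` -/

/-- The list `f 0, …, f m`. -/
def pathList (f : ℕ → Q) (m : ℕ) : List Q := (List.range (m + 1)).map f

/-- The weight of the first `m` transitions of the path `f 0, f 1, …`. -/
def partialWeight (V : OneVASS Q) (f : ℕ → Q) (m : ℕ) : ℤ :=
  ∑ i ∈ Finset.range m, V.w (f i) (f (i + 1))

lemma partialWeight_zero (V : OneVASS Q) (f : ℕ → Q) : partialWeight V f 0 = 0 := by
  simp [partialWeight]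

lemma partialWeight_succ (V : OneVASS Q) (f : ℕ → Q) (m : ℕ) :
    partialWeight V f (m + 1) = partialWeight V f m + V.w (f m) (f (m + 1)) := by
  simp [partialWeight, Finset.sum_range_succ]

lemma pathList_zero (f : ℕ → Q) : pathList f 0 = [f 0] := rfl

lemma pathList_succ_eq_cons (f : ℕ → Q) (m : ℕ) :
    pathList f (m + 1) = f 0 :: pathList (fun i => f (i + 1)) m := by
  simp [pathList, List.range_succ_eq_map (n := m + 1), Function.comp_def]

lemma pathList_succ_eq_append (f : ℕ → Q) (m : ℕ) :
    pathList f (m + 1) = pathList f m ++ [f (m + 1)] := by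
  simp [pathList, List.range_succ (n := m + 1)]

@[simp] lemma length_pathList (f : ℕ → Q) (m : ℕ) : (pathList f m).length = m + 1 := by
  simp [pathList]

lemma head?_pathList (f : ℕ → Q) (m : ℕ) : (pathList f m).head? = some (f 0) := by
  cases m <;> simp [pathList_zero, pathList_succ_eq_cons]

lemma getLast?_pathList (f : ℕ → Q) (m : ℕ) : (pathList f m).getLast? = some (f m) := by
  cases m <;> simp [pathList_zero, pathList_succ_eq_append]

lemma take_pathList (f : ℕ → Q) (m i : ℕ) :
    (pathList f m).take (i + 1) = pathList f (min i m) := by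
  simp [pathList, ← List.map_take, List.take_range]

lemma pathWeight_pathList (V : OneVASS Q) (f : ℕ → Q) (m : ℕ) :
    pathWeight V (pathList f m) = partialWeight V f m := by
  induction m generalizing f with
  | zero => simp [pathWeight, pathList_zero, partialWeight_zero]
  | succ m ih =>
    have h := ih (fun i => f (i + 1))
    have h2 : pathList (fun i => f (i + 1)) m = f 1 :: (pathList (fun i => f (i + 1)) m).tail := by
      cases m <;> simp [pathList_zero, pathList_succ_eq_cons]
    rw [pathList_succ_eq_cons]
    simp only [pathWeight, List.tail_cons] at h ⊢
    conv_lhs => rw [h2, List.zipWith_cons_cons, ← h2, List.sum_cons, h]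
    simp [partialWeight, Finset.sum_range_succ']
    ring

lemma isPath_pathList (V : OneVASS Q) (f : ℕ → Q) (m : ℕ) :
    IsPath V (pathList f m) ↔ ∀ i < m, V.delta (f i) (f (i + 1)) := by
  induction m generalizing f with
  | zero => simp [pathList_zero, IsPath]
  | succ m ih =>
    have h := ih (fun i => f (i + 1))
    have h2 : pathList (fun i => f (i + 1)) m = f 1 :: (pathList (fun i => f (i + 1)) m).tail := by
      cases m <;> simp [pathList_zero, pathList_succ_eq_cons]
    rw [pathList_succ_eq_cons, h2, IsPath, ← h2, h]
    constructor
    · rintro ⟨h0, h1⟩ i hi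
      cases i with
      | zero => exact h0
      | succ i => exact h1 i (by omega)
    · intro H
      exact ⟨H 0 (by omega), fun i hi => H (i + 1) (by omega)⟩

lemma counterAt_pathList (V : OneVASS Q) (f : ℕ → Q) (z : ℕ) {m i : ℕ} (hi : i ≤ m) :
    counterAt V z (pathList f m) i = z + partialWeight V f i := by
  rw [counterAt, take_pathList, min_eq_left hi, pathWeight_pathList]

lemma isValidRun_pathList (V : OneVASS Q) (f : ℕ → Q) (m z : ℕ) :
    IsValidRun V (pathList f m) z ↔ (∀ i < m, V.delta (f i) (f (i + 1))) ∧
      ∀ i ≤ m, 0 ≤ z + partialWeight V f i ∧ (z + partialWeight V f i).toNat ∈ V.D (f i) := by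
  have hget : ∀ i (h : i < (pathList f m).length), (pathList f m).get ⟨i, h⟩ = f i := by
    intro i h
    simp [pathList]
  simp only [IsValidRun, IsRun, isPath_pathList, hget]
  simp only [length_pathList, Nat.lt_succ_iff]
  constructor
  · rintro ⟨⟨h1, h2⟩, h3⟩
    refine ⟨h1, fun i hi => ?_⟩
    rw [← counterAt_pathList V f z hi]
    exact ⟨h2 i hi, h3 i hi⟩
  · rintro ⟨h1, h2⟩
    refine ⟨⟨h1, fun i hi => ?_⟩, fun i hi => ?_⟩
    · rw [counterAt_pathList V f z hi]
      exact (h2 i hi).1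
    · rw [counterAt_pathList V f z hi]
      exact (h2 i hi).2

lemma exists_eq_pathList {π : List Q} (h : π ≠ []) :
    ∃ f : ℕ → Q, π = pathList f (π.length - 1) := by
  have hl : 0 < π.length := List.length_pos_of_ne_nil h
  refine ⟨fun i => π.getD i (π.head h), List.ext_getElem (by simp; omega) ?_⟩
  intro i h1 h2
  simp [pathList, h1]

/-- A valid run of length `k` along the states `f` with counter values `h`. -/
structure SeqRun (V : OneVASS Q) (f : ℕ → Q) (h : ℕ → ℕ) (k : ℕ) : Prop where
  delta : ∀ i < k, V.delta (f i) (f (i + 1))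
  step : ∀ i < k, (h (i + 1) : ℤ) = h i + V.w (f i) (f (i + 1))
  valid : ∀ i ≤ k, h i ∈ V.D (f i)

lemma runLenTo_iff (V : OneVASS Q) (c : Q × ℕ) (S : Set (Q × ℕ)) (k : ℕ) :
    RunLenTo V c S k ↔
      ∃ f h, SeqRun V f h k ∧ f 0 = c.1 ∧ h 0 = c.2 ∧ (f k, h k) ∈ S := by
  constructor
  · rintro ⟨π, c', hc', hv, ⟨hh, hl, hw⟩, hlen⟩
    obtain ⟨f, hf⟩ := exists_eq_pathList (π := π) (by rintro rfl; simp at hlen)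
    have hk : π.length - 1 = k := by omega
    rw [hk] at hf
    subst hf
    rw [isValidRun_pathList] at hv
    rw [head?_pathList, Option.some_inj] at hh
    rw [getLast?_pathList, Option.some_inj] at hl
    rw [pathWeight_pathList] at hw
    refine ⟨f, fun i => (c.2 + partialWeight V f i).toNat, ⟨hv.1, ?_, fun i hi => (hv.2 i hi).2⟩,
      hh, by simp [partialWeight_zero], ?_⟩
    · intro i hi
      have h1 := (hv.2 i hi.le).1
      have h2 := (hv.2 (i + 1) hi).1
      rw [Int.toNat_of_nonneg h1, Int.toNat_of_nonneg h2, partialWeight_succ]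
      ring
    · simp only [← hw, Int.toNat_natCast]
      rw [hl]
      exact hc'
  · rintro ⟨f, h, hr, h0, hz, hS⟩
    have key : ∀ i ≤ k, (c.2 : ℤ) + partialWeight V f i = h i := by
      intro i
      induction i with
      | zero => simp [partialWeight_zero, hz]
      | succ i ih =>
        intro hi
        rw [partialWeight_succ, hr.step i (by omega), ← ih (by omega)]
        ring
    refine ⟨pathList f k, (f k, h k), hS, ?_, ⟨?_, ?_, ?_⟩, by simp⟩
    · rw [isValidRun_pathList]
      refine ⟨hr.delta, fun i hi => ?_⟩
      rw [key i hi]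
      exact ⟨by positivity, by simpa using hr.valid i hi⟩
    · rw [head?_pathList, h0]
    · rw [getLast?_pathList]
    · rw [pathWeight_pathList, key k le_rfl]

lemma le_foldr_min_iff (l : List ℤ) (c : ℤ) : c ≤ l.foldr min 0 ↔ c ≤ 0 ∧ ∀ x ∈ l, c ≤ x := by
  induction l with
  | nil => simp
  | cons a l ih => simp [ih]; tauto

lemma le_pmin_pathList_iff (V : OneVASS Q) (f : ℕ → Q) (m : ℕ) (c : ℤ) :
    c ≤ pmin V (pathList f m) ↔ ∀ i ≤ m, c ≤ partialWeight V f i := by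
  rw [pmin, le_foldr_min_iff]
  simp only [List.mem_map, List.mem_range, length_pathList, forall_exists_index, and_imp,
    forall_apply_eq_imp_iff₂]
  constructor
  · rintro ⟨-, h2⟩ i hi
    simpa [take_pathList, min_eq_left hi, pathWeight_pathList] using h2 (i + 1) (by omega)
  · intro h
    refine ⟨by simpa [partialWeight_zero] using h 0 (by omega), fun i hi => ?_⟩
    cases i with
    | zero => simpa [partialWeight_zero, pathWeight] using h 0 (by omega)
    | succ i =>
      rw [take_pathList, min_eq_left (by omega), pathWeight_pathList]
      exact h i (by omega)

/-! ### Iterating the chosen cycles -/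

lemma IsCycleOn.exists_periodic {V : OneVASS Q} {π : List Q} {q : Q} (h : IsCycleOn V π q) :
    ∃ (f : ℕ → Q) (m : ℕ), 1 ≤ m ∧ π = pathList f m ∧ (∀ i, f (i + m) = f i) ∧ f 0 = q := by
  obtain ⟨-, hlen, hhead, hlast⟩ := h
  obtain ⟨f, hf⟩ := exists_eq_pathList (π := π) (by rintro rfl; simp at hlen)
  obtain ⟨m, hm⟩ : ∃ m, m = π.length - 1 := ⟨_, rfl⟩
  rw [← hm] at hf
  have hm1 : 1 ≤ m := by omega
  have h0 : f 0 = q := by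
    rw [hf, head?_pathList, Option.some_inj] at hhead
    exact hhead
  have h1 : f m = q := by
    rw [hf, getLast?_pathList, Option.some_inj] at hlast
    exact hlast
  refine ⟨fun i => f (i % m), m, hm1, ?_, fun i => by simp, by simpa using h0⟩
  rw [hf]
  refine List.map_congr_left fun i hi => ?_
  rw [List.mem_range] at hi
  rcases Nat.lt_succ_iff_lt_or_eq.mp hi with h | h
  · rw [Nat.mod_eq_of_lt h]
  · rw [h, Nat.mod_self, h0, h1]

lemma partialWeight_add (V : OneVASS Q) {f : ℕ → Q} {a : ℕ} (hf : ∀ i, f (i + a) = f i) (b : ℕ) :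
    partialWeight V f (a + b) = partialWeight V f a + partialWeight V f b := by
  induction b with
  | zero => simp [partialWeight_zero]
  | succ b ih =>
    rw [← add_assoc, partialWeight_succ, partialWeight_succ, ih, ← hf b, ← hf (b + 1)]
    rw [show b + a = a + b by ring, show b + 1 + a = a + b + 1 by ring]
    ring

lemma periodic_mul {f : ℕ → Q} {m : ℕ} (hf : ∀ i, f (i + m) = f i) (j i : ℕ) :
    f (i + j * m) = f i := by
  induction j with
  | zero => simp
  | succ j ih => rw [Nat.succ_mul, ← add_assoc, hf, ih]

lemma partialWeight_mul_add (V : OneVASS Q) {f : ℕ → Q} {m : ℕ} (hf : ∀ i, f (i + m) = f i)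
    (j i : ℕ) : partialWeight V f (j * m + i) = j * partialWeight V f m + partialWeight V f i := by
  have hj : partialWeight V f (j * m) = j * partialWeight V f m := by
    induction j with
    | zero => simp [partialWeight_zero]
    | succ j ih =>
      rw [Nat.succ_mul, partialWeight_add V (periodic_mul hf j), ih]
      push_cast
      ring
  rw [partialWeight_add V (periodic_mul hf j), hj]

lemma iterCycle_pathList {f : ℕ → Q} {m : ℕ} (hf : ∀ i, f (i + m) = f i) (k : ℕ) :
    iterCycle (pathList f m) k = pathList f ((k + 1) * m) := by
  induction k with
  | zero => simp [iterCycle]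
  | succ k ih =>
    have h1 : (pathList f m).tail = (List.range m).map fun i => f (i + 1) := by
      simp [pathList, List.range_succ_eq_map (n := m), Function.comp_def]
    have h2 : List.range ((k + 1 + 1) * m + 1) = List.range ((k + 1) * m + 1) ++
        (List.range m).map fun i => (k + 1) * m + 1 + i := by
      rw [← List.range_add]
      congr 1
      ring
    rw [iterCycle, ih, h1, pathList, pathList, h2, List.map_append, List.map_map]
    congr 1
    refine List.map_congr_left fun i _ => ?_
    rw [Function.comp_apply, show (k + 1) * m + 1 + i = (i + 1) + (k + 1) * m by ring,
      periodic_mul hf]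

lemma isValidRun_mul_pathList {V : OneVASS Q} {f : ℕ → Q} {m W : ℕ} (hm : 1 ≤ m)
    (hf : ∀ i, f (i + m) = f i) (hW : partialWeight V f m = W) (k z : ℕ) :
    IsValidRun V (pathList f ((k + 1) * m)) z ↔
      ∀ j ≤ k, IsValidRun V (pathList f m) (z + j * W) := by
  have hcast : ∀ j i : ℕ, ((z + j * W : ℕ) : ℤ) + partialWeight V f i
      = z + partialWeight V f (j * m + i) := by
    intro j i
    rw [partialWeight_mul_add V hf, hW]
    push_cast
    ring
  have hper : ∀ j i : ℕ, f (j * m + i) = f i := by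
    intro j i
    rw [add_comm, periodic_mul hf]
  simp only [isValidRun_pathList, hcast]
  constructor
  · rintro ⟨h1, h2⟩ j hj
    have hjm : j * m + m ≤ (k + 1) * m := by
      rw [← Nat.succ_mul]
      exact Nat.mul_le_mul_right _ (by omega)
    refine ⟨fun i hi => ?_, fun i hi => ?_⟩
    · have := h1 (j * m + i) (by omega)
      rwa [add_assoc, hper, hper] at this
    · have := h2 (j * m + i) (by omega)
      rwa [hper] at this
  · intro H
    have hlt : ∀ i < (k + 1) * m, i / m ≤ k := fun i hi =>
      Nat.lt_succ_iff.mp (Nat.div_lt_of_lt_mul (by rwa [mul_comm]))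
    have hdm : ∀ i, i / m * m + i % m = i := fun i => Nat.div_add_mod' i m
    have hmod : ∀ i, i % m < m := fun i => Nat.mod_lt _ (by omega)
    refine ⟨fun i hi => ?_, fun i hi => ?_⟩
    · have := (H (i / m) (hlt i hi)).1 (i % m) (hmod i)
      rwa [← hper (i / m) (i % m), ← hper (i / m) (i % m + 1), ← add_assoc, hdm] at this
    · rcases hi.lt_or_eq with hi | rfl
      · have := (H (i / m) (hlt i hi)).2 (i % m) (hmod i).le
        rwa [← hper (i / m) (i % m), hdm] at this
      · have := (H k le_rfl).2 m le_rfl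
        rwa [← hper k m, ← Nat.succ_mul] at this

/-- The chosen cycle on `q` can be validly traversed from counter value `u`. -/
def Traversable (V : OneVASS Q) (γ : Q → List Q) (q : Q) (u : ℕ) : Prop :=
  IsValidRun V (γ q) u

/-- `y` is reached from `x` by validly iterating the chosen cycle on `q`. -/
def Linked (V : OneVASS Q) (γ : Q → List Q) (q : Q) (x y : ℕ) : Prop :=
  ∃ j, y = x + j * Wnat V γ q ∧ ∀ i < j, Traversable V γ q (x + i * Wnat V γ q)

section Chains

variable {V : OneVASS Q} {γ : Q → List Q} {q : Q}

lemma Wnat_pos (hγ : GammaChoice V γ) (hq : q ∈ Qplus V) : 0 < Wnat V γ q := by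
  have := (hγ q hq).2.1
  rw [Wnat]
  omega

lemma chainLinked_iff (hγ : GammaChoice V γ) (hq : q ∈ Qplus V) (x y : ℕ) :
    chainLinked V γ q x y ↔ x < y ∧ Linked V γ q x y := by
  obtain ⟨f, m, hm, hπ, hf, -⟩ := (hγ q hq).1.1.exists_periodic
  have hWpos := Wnat_pos hγ hq
  have hW : partialWeight V f m = Wnat V γ q := by
    have := (hγ q hq).2.1
    rw [Wnat, Int.toNat_of_nonneg this.le, hπ, pathWeight_pathList]
  have hk : ∀ k, partialWeight V f ((k + 1) * m) = (k + 1 : ℕ) * Wnat V γ q := by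
    intro k
    have := partialWeight_mul_add V hf (k + 1) 0
    simpa [partialWeight_zero, hW] using this
  have hrun : ∀ k, IsValidRun V (iterCycle (γ q) k) x ↔
      ∀ j ≤ k, Traversable V γ q (x + j * Wnat V γ q) := by
    intro k
    simp only [Traversable, hπ]
    rw [iterCycle_pathList hf, isValidRun_mul_pathList hm hf hW]
  have hwt : ∀ k, pathWeight V (iterCycle (γ q) k) = (k + 1 : ℕ) * Wnat V γ q := by
    intro k
    rw [hπ, iterCycle_pathList hf, pathWeight_pathList, hk]
  simp only [chainLinked, hrun, hwt]
  constructor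
  · rintro ⟨k, h1, h2⟩
    have h2' : y = x + (k + 1) * Wnat V γ q := by exact_mod_cast h2
    exact ⟨by rw [h2']; nlinarith, k + 1, h2', fun i hi => h1 i (by omega)⟩
  · rintro ⟨hlt, j, hy, hj⟩
    obtain ⟨k, rfl⟩ : ∃ k, j = k + 1 := by
      refine ⟨j - 1, ?_⟩
      rcases j with _ | j
      · simp at hy; omega
      · rfl
    exact ⟨k, fun i hi => hj i (by omega), by exact_mod_cast hy⟩

lemma Linked.refl (x : ℕ) : Linked V γ q x x := ⟨0, by simp, by simp⟩

lemma Linked.le {x y : ℕ} (h : Linked V γ q x y) : x ≤ y := by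
  obtain ⟨j, rfl, -⟩ := h
  omega

lemma Linked.mod_eq {x y : ℕ} (h : Linked V γ q x y) : y % Wnat V γ q = x % Wnat V γ q := by
  obtain ⟨j, rfl, -⟩ := h
  simp

lemma Linked.trans {x y z : ℕ} (h1 : Linked V γ q x y) (h2 : Linked V γ q y z) :
    Linked V γ q x z := by
  obtain ⟨j, rfl, hj⟩ := h1
  obtain ⟨l, rfl, hl⟩ := h2
  refine ⟨j + l, by ring, fun i hi => ?_⟩
  rcases lt_or_ge i j with h | h
  · exact hj i h
  · obtain ⟨t, rfl⟩ := Nat.exists_eq_add_of_le h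
    have := hl t (by omega)
    rwa [add_assoc, ← add_mul] at this

/-- Values linked from, or to, a common value are comparable. -/
lemma Linked.of_left (hW : 0 < Wnat V γ q) {x y z : ℕ} (h1 : Linked V γ q x y)
    (h2 : Linked V γ q x z) (hyz : y ≤ z) : Linked V γ q y z := by
  obtain ⟨j, rfl, hj⟩ := h1
  obtain ⟨l, rfl, hl⟩ := h2
  have hjl : j ≤ l := Nat.le_of_mul_le_mul_right (by omega) hW
  obtain ⟨t, rfl⟩ := Nat.exists_eq_add_of_le hjl
  refine ⟨t, by ring, fun i hi => ?_⟩
  have := hl (j + i) (by omega)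
  rwa [add_mul, ← add_assoc] at this

lemma Linked.of_right (hW : 0 < Wnat V γ q) {x y z : ℕ} (h1 : Linked V γ q x z)
    (h2 : Linked V γ q y z) (hxy : x ≤ y) : Linked V γ q x y := by
  obtain ⟨j, rfl, hj⟩ := h1
  obtain ⟨l, hl, -⟩ := h2
  have hlj : l ≤ j := Nat.le_of_mul_le_mul_right (by omega) hW
  obtain ⟨t, rfl⟩ := Nat.exists_eq_add_of_le hlj
  refine ⟨t, ?_, fun i hi => hj i (by omega)⟩
  rw [add_mul] at hl
  omega

lemma Linked.between (hW : 0 < Wnat V γ q) {x y z : ℕ} (h : Linked V γ q x z) (hxy : x ≤ y)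
    (hyz : y ≤ z) (hmod : y % Wnat V γ q = x % Wnat V γ q) : Linked V γ q x y := by
  obtain ⟨j, rfl, hj⟩ := h
  obtain ⟨l, hl⟩ := (Nat.modEq_iff_dvd' hxy).mp hmod.symm
  obtain rfl : y = x + l * Wnat V γ q := by rw [mul_comm] at hl; omega
  have hlj : l ≤ j := Nat.le_of_mul_le_mul_right (by omega) hW
  exact ⟨l, rfl, fun i hi => hj i (by omega)⟩

lemma confPlus_mono {x y : ℕ} (hx : (q, x) ∈ ConfPlus V γ) (hxy : x ≤ y) :
    (q, y) ∈ ConfPlus V γ := by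
  refine ⟨hx.1, ?_⟩
  have := hx.2
  simp only at this ⊢
  omega

/-- Every configuration of `Conf₊` lies in a chain containing everything linked to it. -/
lemma exists_chain (hγ : GammaChoice V γ) {x : ℕ} (hx : (q, x) ∈ ConfPlus V γ) :
    ∃ C, IsChain V γ C ∧ (q, x) ∈ C ∧ ∀ y, Linked V γ q x y → (q, y) ∈ C := by
  have hq : q ∈ Qplus V := hx.1
  have hW := Wnat_pos hγ hq
  refine ⟨{c | c ∈ ConfPlus V γ ∧ c.1 = q ∧ (Linked V γ q x c.2 ∨ Linked V γ q c.2 x)},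
    ⟨q, x % Wnat V γ q, hq, Nat.mod_lt _ hW, ?_, ?_, ?_⟩, ⟨hx, rfl, Or.inl (Linked.refl x)⟩,
    fun y hy => ⟨confPlus_mono hx hy.le, rfl, Or.inl hy⟩⟩
  · rintro ⟨p, y⟩ ⟨h1, rfl, h2⟩
    exact ⟨h1, rfl, h2.elim (fun h => h.mod_eq) fun h => h.mod_eq.symm⟩
  · rintro ⟨p, y⟩ ⟨-, -, hy⟩ ⟨p', y'⟩ ⟨-, -, hy'⟩ hlt
    simp only at hy hy' hlt
    rw [chainLinked_iff hγ hq]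
    refine ⟨hlt, ?_⟩
    rcases hy with hy | hy <;> rcases hy' with hy' | hy'
    · exact hy.of_left hW hy' hlt.le
    · exact absurd (hy.le.trans_lt hlt) (not_lt.mpr hy'.le)
    · exact hy.trans hy'
    · exact hy.of_right hW hy' hlt.le
  · intro C' hsub hres hcond
    refine Set.Subset.antisymm ?_ hsub
    rintro ⟨p, y⟩ hy
    have hy' := hres hy
    have hxC : (q, x) ∈ C' := hsub ⟨hx, rfl, Or.inl (Linked.refl x)⟩
    refine ⟨hy'.1, hy'.2.1, ?_⟩
    rcases lt_trichotomy x y with h | h | h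
    · exact Or.inl ((chainLinked_iff hγ hq x y).mp (hcond _ hxC _ hy h)).2
    · exact Or.inl (h ▸ Linked.refl x)
    · exact Or.inr ((chainLinked_iff hγ hq y x).mp (hcond _ hy _ hxC h)).2

lemma IsChain.linked (hγ : GammaChoice V γ) {C : Set (Q × ℕ)} (hC : IsChain V γ C)
    {c c' : Q × ℕ} (hc : c ∈ C) (hc' : c' ∈ C) (hle : c.2 ≤ c'.2) :
    c ∈ ConfPlus V γ ∧ c'.1 = c.1 ∧ Linked V γ c.1 c.2 c'.2 := by
  obtain ⟨q, r, hq, -, hres, hcond, -⟩ := hC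
  obtain ⟨h1, rfl, -⟩ := hres hc
  refine ⟨h1, (hres hc').2.1, ?_⟩
  rcases hle.lt_or_eq with h | h
  · exact ((chainLinked_iff hγ hq _ _).mp (hcond _ hc _ hc' h)).2
  · exact h ▸ Linked.refl _

lemma dcClosed_iff (hγ : GammaChoice V γ) (S : Set (Q × ℕ)) :
    dcClosed V γ S ↔ ∀ q x y, (q, x) ∈ ConfPlus V γ → Linked V γ q x y → (q, y) ∈ S →
      (q, x) ∈ S := by
  constructor
  · intro h q x y hx hxy hy
    obtain ⟨C, hC, hxC, hyC⟩ := exists_chain hγ hx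
    exact h C hC (q, y) ⟨hy, hyC y hxy⟩ (q, x) hxC hxy.le
  · rintro h C hC ⟨q, y⟩ ⟨hyS, hyC⟩ ⟨q', x⟩ hxC hle
    obtain ⟨h1, h2, h3⟩ := hC.linked hγ hxC hyC hle
    simp only at h2
    subst h2
    exact h _ _ _ h1 h3 hyS

lemma mem_U_zero_iff (hγ : GammaChoice V γ) (x : ℕ) :
    (q, x) ∈ U V γ 0 ↔
      (q, x) ∈ ConfPlus V γ ∧ ∀ j, Traversable V γ q (x + j * Wnat V γ q) := by
  constructor
  · rintro ⟨C, ⟨hC, hub⟩, hx⟩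
    have hx' := hC.linked hγ hx hx le_rfl
    refine ⟨hx'.1, fun j => ?_⟩
    rw [chainBounded, not_bddAbove_iff] at hub
    obtain ⟨-, ⟨c, hc, rfl⟩, hlt⟩ := hub (x + j * Wnat V γ q)
    obtain ⟨-, -, l, hl, hl'⟩ := hC.linked hγ hx hc (by simp only; omega)
    refine hl' j ?_
    simp only at hl
    rw [hl] at hlt
    exact lt_of_mul_lt_mul_right (lt_of_add_lt_add_left hlt) (Nat.zero_le _)
  · rintro ⟨hx, hall⟩
    obtain ⟨C, hC, hxC, hyC⟩ := exists_chain hγ hx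
    refine ⟨C, ⟨hC, ?_⟩, hxC⟩
    rw [chainBounded, not_bddAbove_iff]
    intro b
    refine ⟨x + (b + 1) * Wnat V γ q, ⟨_, hyC _ ⟨b + 1, rfl, fun i _ => hall i⟩, rfl⟩, ?_⟩
    nlinarith [Wnat_pos hγ hx.1]

lemma U_subset_succ (n : ℕ) : U V γ n ⊆ U V γ (n + 1) :=
  fun _ hc => Set.mem_sInter.mpr fun _ hS => hS.1 (Or.inl hc)

lemma U_mono : Monotone (U V γ) := monotone_nat_of_le_succ U_subset_succ

lemma Uprime_subset_succ (n : ℕ) : Uprime V γ (U V γ n) ⊆ U V γ (n + 1) :=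
  fun _ hc => Set.mem_sInter.mpr fun _ hS => hS.1 (Or.inr hc)

lemma U_of_linked (hγ : GammaChoice V γ) {n x y : ℕ} (hx : (q, x) ∈ ConfPlus V γ)
    (hxy : Linked V γ q x y) (hy : (q, y) ∈ U V γ n) : (q, x) ∈ U V γ n := by
  cases n with
  | zero =>
    rw [mem_U_zero_iff hγ] at hy ⊢
    refine ⟨hx, fun j => ?_⟩
    obtain ⟨l, rfl, hl⟩ := hxy
    rcases lt_or_ge j l with h | h
    · exact hl j h
    · obtain ⟨t, rfl⟩ := Nat.exists_eq_add_of_le h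
      rw [add_mul, ← add_assoc]
      exact hy.2 t
  | succ n =>
    exact Set.mem_sInter.mpr fun S hS =>
      (dcClosed_iff hγ S).mp hS.2 q x y hx hxy (Set.mem_sInter.mp hy S hS)

lemma U_subset_confPlus (hγ : GammaChoice V γ) (n : ℕ) : U V γ n ⊆ ConfPlus V γ := by
  induction n with
  | zero =>
    rintro ⟨q, x⟩ hx
    exact ((mem_U_zero_iff hγ x).mp hx).1
  | succ n ih =>
    refine Set.sInter_subset_of_mem ⟨Set.union_subset ih fun c hc => hc.1.1, ?_⟩
    exact (dcClosed_iff hγ _).mpr fun q x y hx _ _ => hx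

lemma exists_linked_of_mem_U_succ (hγ : GammaChoice V γ) {n x : ℕ}
    (hx : (q, x) ∈ U V γ (n + 1)) :
    ∃ y, Linked V γ q x y ∧ (q, y) ∈ U V γ n ∪ Uprime V γ (U V γ n) := by
  suffices h : U V γ (n + 1) ⊆ {c : Q × ℕ | ∃ y, Linked V γ c.1 c.2 y ∧
    (c.1, y) ∈ U V γ n ∪ Uprime V γ (U V γ n)} from h hx
  refine Set.sInter_subset_of_mem ⟨?_, ?_⟩
  · rintro c hc
    exact ⟨c.2, Linked.refl _, hc⟩
  · rw [dcClosed_iff hγ]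
    rintro q x y - hxy ⟨z, hz, hzU⟩
    exact ⟨z, hxy.trans hz, hzU⟩

lemma U_succ_eq_of_Uprime_eq_empty (hγ : GammaChoice V γ) {n : ℕ}
    (h : Uprime V γ (U V γ n) = ∅) : U V γ (n + 1) = U V γ n := by
  refine (Set.Subset.antisymm (U_subset_succ n) ?_).symm
  rintro ⟨q, x⟩ hx
  obtain ⟨y, hy, hyU⟩ := exists_linked_of_mem_U_succ hγ hx
  rw [h, Set.union_empty] at hyU
  exact U_of_linked hγ (U_subset_confPlus hγ _ hx) hy hyU

lemma U_eq_of_succ_eq {n : ℕ} (h : U V γ (n + 1) = U V γ n) {m : ℕ} (hm : n ≤ m) :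
    U V γ m = U V γ n := by
  induction m, hm using Nat.le_induction with
  | base => rfl
  | succ m _ ih =>
    rw [← h, U, U, ih]

end Chains

/-! ### Blocked counter values -/

lemma SingleGuard.exists_guard {V : OneVASS Q} (h : SingleGuard V) :
    ∃ g : Q → ℕ, ∀ q z, z ≠ g q → z ∈ V.D q := by
  have : ∀ q, ∃ g, ∀ z, z ≠ g → z ∈ V.D q := by
    intro q
    rcases h q with h | ⟨g, h⟩
    · exact ⟨0, by simp [h]⟩
    · exact ⟨g, by simp [h]⟩
  choose g hg using this
  exact ⟨g, hg⟩

/-- `B q` consists of at most `N` values and contains all values of `Conf₊` at `q` from which the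
chosen cycle cannot be traversed. -/
structure IsBlocking (V : OneVASS Q) (γ : Q → List Q) (N : ℕ) (B : Q → Finset ℕ) : Prop where
  card_le : ∀ q ∈ Qplus V, (B q).card ≤ N
  mem : ∀ q u, (q, u) ∈ ConfPlus V γ → ¬ Traversable V γ q u → u ∈ B q

lemma exists_isBlocking [Fintype Q] {V : OneVASS Q} {γ : Q → List Q} (hγ : GammaChoice V γ)
    (hg : SingleGuard V) : ∃ B, IsBlocking V γ (Fintype.card Q + 1) B := by
  obtain ⟨g, hg⟩ := hg.exists_guard
  have key : ∀ q, ∃ B : Finset ℕ, q ∈ Qplus V → B.card ≤ Fintype.card Q + 1 ∧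
      ∀ u, (q, u) ∈ ConfPlus V γ → ¬ Traversable V γ q u → u ∈ B := by
    intro q
    by_cases hq : q ∈ Qplus V
    swap
    · exact ⟨∅, fun h => absurd h hq⟩
    have hsimple := (hγ q hq).1
    obtain ⟨f, m, hm, hπ, hf, -⟩ := hsimple.1.exists_periodic
    have hmQ : m ≤ Fintype.card Q := by
      have := hsimple.2.length_le_card
      simpa [hπ] using this
    refine ⟨(Finset.range (m + 1)).image fun i => ((g (f i) : ℤ) - partialWeight V f i).toNat,
      fun _ => ⟨Finset.card_image_le.trans (by simpa using hmQ), fun u hu hnot => ?_⟩⟩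
    have hmin : ∀ i ≤ m, -(u : ℤ) ≤ partialWeight V f i := by
      rw [← le_pmin_pathList_iff, ← hπ]
      have := hu.2
      simp only at this
      omega
    have hdelta : ∀ i < m, V.delta (f i) (f (i + 1)) := by
      rw [← isPath_pathList, ← hπ]
      exact hsimple.1.1
    rw [Traversable, hπ, isValidRun_pathList] at hnot
    have : ∃ i ≤ m, (u + partialWeight V f i).toNat ∉ V.D (f i) := by
      by_contra! H
      exact hnot ⟨hdelta, fun i hi => ⟨by have := hmin i hi; omega, H i hi⟩⟩
    obtain ⟨i, hi, hD⟩ := this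
    have hgi : (u + partialWeight V f i).toNat = g (f i) := by
      by_contra h
      exact hD (hg _ _ h)
    rw [Finset.mem_image]
    have := hmin i hi
    exact ⟨i, Finset.mem_range.mpr (by omega), by omega⟩
  choose B hB using key
  exact ⟨B, fun q hq => (hB q hq).1, fun q u hu => (hB q hu.1).2 u hu⟩

section Counting

variable {V : OneVASS Q} {γ : Q → List Q} {q : Q} {N : ℕ} {B : Q → Finset ℕ}

lemma exists_linked_blocked (hγ : GammaChoice V γ) (hB : IsBlocking V γ N B) {n x : ℕ}
    (hx : (q, x) ∈ ConfPlus V γ \ U V γ n) : ∃ y ∈ B q, Linked V γ q x y := by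
  classical
  have h0 : (q, x) ∉ U V γ 0 := fun h => hx.2 (U_mono (Nat.zero_le n) h)
  rw [mem_U_zero_iff hγ] at h0
  have hex : ∃ j, ¬ Traversable V γ q (x + j * Wnat V γ q) := by
    by_contra! H
    exact h0 ⟨hx.1, H⟩
  refine ⟨x + Nat.find hex * Wnat V γ q,
    hB.mem q _ (confPlus_mono hx.1 (Nat.le_add_right _ _)) (Nat.find_spec hex),
    Nat.find hex, rfl, fun i hi => ?_⟩
  by_contra h
  exact Nat.find_min hex hi h

/-- Configurations outside `U n` lie in at most `N` residue classes. -/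
lemma card_le_of_residues (hγ : GammaChoice V γ) (hB : IsBlocking V γ N B) (hq : q ∈ Qplus V)
    {n : ℕ} {ι : Type*} (I : Finset ι) (v : ι → ℕ)
    (hv : ∀ i ∈ I, (q, v i) ∈ ConfPlus V γ \ U V γ n)
    (hinj : ∀ i ∈ I, ∀ j ∈ I, v i % Wnat V γ q = v j % Wnat V γ q → i = j) : I.card ≤ N := by
  classical
  have : ∀ i, ∃ y, i ∈ I → y ∈ B q ∧ Linked V γ q (v i) y := by
    intro i
    by_cases hi : i ∈ I
    · obtain ⟨y, hy⟩ := exists_linked_blocked hγ hB (hv i hi)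
      exact ⟨y, fun _ => hy⟩
    · exact ⟨0, fun h => absurd h hi⟩
  choose y hy using this
  refine (Finset.card_le_card_of_injOn y (fun i hi => (hy i hi).1) ?_).trans (hB.card_le q hq)
  intro i hi j hj hij
  exact hinj i hi j hj (by rw [← (hy i hi).2.mod_eq, ← (hy j hj).2.mod_eq, hij])

lemma card_le_of_mem_window (hγ : GammaChoice V γ) (hB : IsBlocking V γ N B)
    (hq : q ∈ Qplus V) {n : ℕ} (F : Finset ℕ) (P : ℕ) (t : ℤ)
    (hF : ∀ x ∈ F, (q, x) ∈ ConfPlus V γ \ U V γ n)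
    (ht : ∀ x ∈ F, t ≤ x ∧ (x : ℤ) < t + P * Wnat V γ q) : F.card ≤ P * N := by
  classical
  have hW : (0 : ℤ) < Wnat V γ q := by exact_mod_cast Wnat_pos hγ hq
  have h := Finset.card_le_mul_card_image_of_maps_to (s := F) (t := Finset.range P)
    (f := fun x : ℕ => (((x : ℤ) - t) / Wnat V γ q).toNat) (n := N) ?_ ?_
  · rwa [Finset.card_range, mul_comm] at h
  · intro x hx
    have h1 := ht x hx
    have h2 : ((x : ℤ) - t) / Wnat V γ q < P := Int.ediv_lt_of_lt_mul hW (by linarith)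
    have h3 : 0 ≤ ((x : ℤ) - t) / Wnat V γ q := Int.ediv_nonneg (by linarith) hW.le
    rw [Finset.mem_range]
    omega
  · intro b _
    refine card_le_of_residues hγ hB hq _ id
      (fun x hx => hF x (Finset.mem_filter.mp hx).1) ?_
    intro x hx y hy hxy
    obtain ⟨hxF, hxb⟩ := Finset.mem_filter.mp hx
    obtain ⟨hyF, hyb⟩ := Finset.mem_filter.mp hy
    have h1 : 0 ≤ ((x : ℤ) - t) / Wnat V γ q :=
      Int.ediv_nonneg (by linarith [(ht x hxF).1]) hW.le
    have h2 : 0 ≤ ((y : ℤ) - t) / Wnat V γ q :=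
      Int.ediv_nonneg (by linarith [(ht y hyF).1]) hW.le
    have h3 : ((x : ℤ) - t) / Wnat V γ q = ((y : ℤ) - t) / Wnat V γ q := by omega
    have h4 : ((x : ℤ) - t) % Wnat V γ q = ((y : ℤ) - t) % Wnat V γ q := by
      have : (x : ℤ) ≡ y [ZMOD Wnat V γ q] := (Int.natCast_modEq_iff).mpr hxy
      exact this.sub_right t
    have h5 := Int.emod_add_mul_ediv ((x : ℤ) - t) (Wnat V γ q)
    have h6 := Int.emod_add_mul_ediv ((y : ℤ) - t) (Wnat V γ q)
    rw [h3, h4, h6] at h5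
    omega

/-- Each bounded chain is entered from below by at most one step from `U n` to its complement. -/
lemma card_le_of_entries (hγ : GammaChoice V γ) (hB : IsBlocking V γ N B) (hq : q ∈ Qplus V)
    {n : ℕ} (F : Finset ℕ)
    (hF : ∀ x ∈ F, (q, x) ∈ U V γ n ∧ (q, x + Wnat V γ q) ∉ U V γ n) : F.card ≤ N := by
  classical
  have hW := Wnat_pos hγ hq
  have hconf : ∀ x ∈ F, (q, x + Wnat V γ q) ∈ ConfPlus V γ := fun x hx =>
    confPlus_mono (U_subset_confPlus hγ n (hF x hx).1) (Nat.le_add_right _ _)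
  have : ∀ x, ∃ y, x ∈ F → y ∈ B q ∧ Linked V γ q (x + Wnat V γ q) y := by
    intro x
    by_cases hx : x ∈ F
    · obtain ⟨y, hy⟩ := exists_linked_blocked hγ hB ⟨hconf x hx, (hF x hx).2⟩
      exact ⟨y, fun _ => hy⟩
    · exact ⟨0, fun h => absurd h hx⟩
  choose y hy using this
  have key : ∀ x ∈ F, ∀ x' ∈ F, y x = y x' → ¬ x < x' := by
    intro x hx x' hx' heq hlt
    have h1 := (hy x hx).2
    have h2 := (hy x' hx').2
    rw [← heq] at h2
    have hmod : x' % Wnat V γ q = x % Wnat V γ q := by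
      have h3 := h1.mod_eq
      have h4 := h2.mod_eq
      simp only [Nat.add_mod_right] at h3 h4
      omega
    have hle : x + Wnat V γ q ≤ x' := by
      obtain ⟨l, hl⟩ := (Nat.modEq_iff_dvd' hlt.le).mp hmod.symm
      have : 1 ≤ l := by
        rcases l with _ | l
        · omega
        · omega
      nlinarith [Nat.sub_add_cancel hlt.le]
    exact (hF x hx).2 (U_of_linked hγ (hconf x hx)
      (h1.between hW hle (by have := h2.le; omega) (by simpa using hmod)) (hF x' hx').1)
  refine (Finset.card_le_card_of_injOn y (fun x hx => (hy x hx).1) ?_).trans (hB.card_le q hq)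
  intro x hx x' hx' heq
  have h1 := key x hx x' hx' heq
  have h2 := key x' hx' x hx heq.symm
  omega

end Counting

/-! ### Shortening runs by jumping between visits of a state -/

/-- A path through the states `f (p 0), …, f (p m)` that follows transitions of `f`, but after each
transition may jump forward to a later visit of the current state; `H` is its counter. -/
structure JumpPath (V : OneVASS Q) (f : ℕ → Q) (p : ℕ → ℕ) (H : ℕ → ℤ) (m : ℕ) : Prop where
  lt : ∀ t < m, p t < p (t + 1)
  state : ∀ t < m, f (p t + 1) = f (p (t + 1))
  step : ∀ t < m, H (t + 1) = H t + V.w (f (p t)) (f (p (t + 1)))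

section Jump

variable {V : OneVASS Q} {f : ℕ → Q} {p : ℕ → ℕ} {H : ℕ → ℤ} {m : ℕ}

lemma JumpPath.add_le (h : JumpPath V f p H m) {s t : ℕ} (hst : s ≤ t) (ht : t ≤ m) :
    p s + (t - s) ≤ p t := by
  induction t, hst using Nat.le_induction with
  | base => simp
  | succ t hst ih =>
    have h1 := ih (by omega)
    have h2 := h.lt t (by omega)
    omega

lemma JumpPath.mono (h : JumpPath V f p H m) {s t : ℕ} (hst : s ≤ t) (ht : t ≤ m) :
    p s ≤ p t :=
  (Nat.le_add_right _ _).trans (h.add_le hst ht)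

lemma JumpPath.drop (h : JumpPath V f p H m) {j : ℕ} (hj : j ≤ m) :
    JumpPath V f (fun t => p (t + j)) (fun t => H (t + j)) (m - j) := by
  refine ⟨fun t ht => ?_, fun t ht => ?_, fun t ht => ?_⟩
  · simpa [Nat.add_right_comm] using h.lt (t + j) (by omega)
  · simpa [Nat.add_right_comm] using h.state (t + j) (by omega)
  · simpa [Nat.add_right_comm] using h.step (t + j) (by omega)

lemma JumpPath.join (h : JumpPath V f p H m) {p' : ℕ → ℕ} {H' : ℕ → ℤ} {m' : ℕ}
    (h' : JumpPath V f p' H' m') {i : ℕ} (hi : i ≤ m) (hf : f (p i) = f (p' 0))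
    (hp : p i ≤ p' 0) :
    JumpPath V f (fun t => if t < i then p t else p' (t - i))
      (fun t => if t < i then H t else H' (t - i) + (H i - H' 0)) (i + m') := by
  refine ⟨fun t ht => ?_, fun t ht => ?_, fun t ht => ?_⟩
  all_goals
    rcases lt_trichotomy (t + 1) i with hti | hti | hti
  · simpa [hti, (by omega : t < i)] using h.lt t (by omega)
  · subst hti
    have := h.lt t (by omega)
    simp
    omega
  · have hne₁ : ¬ t + 1 < i := by omega
    have hne₂ : ¬ t < i := by omega
    simp only [if_neg hne₁, if_neg hne₂, (by omega : t + 1 - i = t - i + 1)]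
    exact h'.lt (t - i) (by omega)
  · simpa [hti, (by omega : t < i)] using h.state t (by omega)
  · subst hti
    have := h.state t (by omega)
    simp [this, hf]
  · have hne₁ : ¬ t + 1 < i := by omega
    have hne₂ : ¬ t < i := by omega
    simp only [if_neg hne₁, if_neg hne₂, (by omega : t + 1 - i = t - i + 1)]
    exact h'.state (t - i) (by omega)
  · simpa [hti, (by omega : t < i)] using h.step t (by omega)
  · subst hti
    have := h.step t (by omega)
    simp [this, hf]
  · have hne₁ : ¬ t + 1 < i := by omega
    have hne₂ : ¬ t < i := by omega
    simp only [if_neg hne₁, if_neg hne₂, (by omega : t + 1 - i = t - i + 1)]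
    rw [h'.step (t - i) (by omega)]
    ring

/-- A shortest jump path whose weight has a prescribed residue does not repeat a pair consisting
of a state and a residue. -/
lemma exists_jumpPath {h : ℕ → ℕ} {a b : ℕ} (hab : a ≤ b)
    (hstep : ∀ i, a ≤ i → i < b → (h (i + 1) : ℤ) = h i + V.w (f i) (f (i + 1))) (M : ℤ) :
    ∃ p H m, JumpPath V f p H m ∧ p 0 = a ∧ p m = b ∧ H 0 = 0 ∧ M ∣ H m - (h b - h a) ∧
      ∀ i j, 1 ≤ i → i < j → j ≤ m → f (p i) = f (p j) → ¬ M ∣ H i - H j := by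
  classical
  have hex : ∃ m p H, JumpPath V f p H m ∧ p 0 = a ∧ p m = b ∧ H 0 = 0 ∧
      M ∣ H m - (h b - h a) := by
    refine ⟨b - a, fun t => a + t, fun t => h (a + t) - h a, ⟨fun t _ => by simp, fun t _ => rfl,
      fun t ht => ?_⟩, rfl, by simp; omega, by simp, ?_⟩
    · have := hstep (a + t) (by omega) (by omega)
      rw [← add_assoc, this]
      ring
    · simp only [Nat.add_sub_cancel' hab, sub_self, dvd_zero]
  obtain ⟨p, H, hJ, hp0, hpm, hH0, hM⟩ := Nat.find_spec hex
  refine ⟨p, H, Nat.find hex, hJ, hp0, hpm, hH0, hM, fun i j hi hij hj hf hdvd => ?_⟩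
  refine Nat.find_min hex (m := i + (Nat.find hex - j)) (by omega)
    ⟨_, _, hJ.join (hJ.drop hj) (by omega) (by simpa using hf)
      (by simpa using hJ.mono hij.le hj), ?_, ?_, ?_, ?_⟩
  · simp [hp0, (by omega : 0 < i)]
  · simp [Nat.sub_add_cancel hj, hpm]
  · simp [hH0, (by omega : 0 < i)]
  · simp only [add_lt_iff_neg_left, not_lt_zero, if_false, Nat.add_sub_cancel_left,
      Nat.sub_add_cancel hj, Nat.zero_add]
    rw [add_sub_right_comm]
    exact dvd_add hM hdvd

lemma exists_jumpPath_nodup {h : ℕ → ℕ} {a b : ℕ} (hab : a ≤ b)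
    (hstep : ∀ i, a ≤ i → i < b → (h (i + 1) : ℤ) = h i + V.w (f i) (f (i + 1))) :
    ∃ p H m, JumpPath V f p H m ∧ p 0 = a ∧ p m = b ∧ H 0 = 0 ∧
      ∀ i j, 1 ≤ i → i < j → j ≤ m → f (p i) ≠ f (p j) := by
  obtain ⟨p, H, m, h1, h2, h3, h4, -, h5⟩ := exists_jumpPath hab hstep 1
  exact ⟨p, H, m, h1, h2, h3, h4, fun i j hi hij hj hf => h5 i j hi hij hj hf (one_dvd _)⟩

/-- If repeated states never have a larger counter value, then jumping only gains height. -/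
lemma JumpPath.height_le (hJ : JumpPath V f p H m) {h : ℕ → ℕ}
    (hstep : ∀ i, p 0 ≤ i → i < p m → (h (i + 1) : ℤ) = h i + V.w (f i) (f (i + 1)))
    (hmono : ∀ a b, p 0 < a → a < b → b ≤ p m → f a = f b → h b ≤ h a) {t : ℕ} (ht : t ≤ m) :
    (h (p t) : ℤ) - h (p 0) ≤ H t - H 0 := by
  induction t with
  | zero => simp
  | succ t ih =>
    have h1 := ih (by omega)
    have h2 := hJ.lt t (by omega)
    have h3 := hJ.mono ht le_rfl
    have h4 := hJ.mono (Nat.zero_le t) (by omega)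
    have h5 := hJ.step t (by omega)
    have h6 := hJ.state t (by omega)
    rw [← h6] at h5
    have h7 := hstep (p t) h4 (by omega)
    have h8 : h (p (t + 1)) ≤ h (p t + 1) := by
      rcases (Nat.succ_le_of_lt h2).lt_or_eq with h | h
      · exact hmono _ _ (by omega) h h3 h6
      · rw [← h]
    have h9 : (h (p (t + 1)) : ℤ) ≤ h (p t + 1) := by exact_mod_cast h8
    linarith

lemma JumpPath.partialWeight_eq (hJ : JumpPath V f p H m) {t : ℕ} (ht : t ≤ m) :
    partialWeight V (fun i => f (p i)) t = H t - H 0 := by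
  induction t with
  | zero => simp [partialWeight_zero]
  | succ t ih =>
    rw [partialWeight_succ, ih (by omega), hJ.step t (by omega)]
    ring

lemma nodup_pathList {g : ℕ → Q} (hg : ∀ i j, i < j → j ≤ m → g i ≠ g j) :
    (pathList g m).Nodup := by
  refine List.Nodup.map_on ?_ List.nodup_range
  intro i hi j hj hij
  rw [List.mem_range] at hi hj
  rcases lt_trichotomy i j with h | h | h
  · exact absurd hij (hg i j h (by omega))
  · exact h
  · exact absurd hij.symm (hg j i h (by omega))

/-- A run closing a positive cycle visits `Conf₊` before. -/
lemma SeqRun.le_of_state_eq {γ : Q → List Q} (hγ : GammaChoice V γ) {h : ℕ → ℕ} {k : ℕ}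
    (hr : SeqRun V f h k) (hconf : ∀ i, 1 ≤ i → i < k → (f i, h i) ∉ ConfPlus V γ)
    {a b : ℕ} (ha : 1 ≤ a) (hab : a < b) (hb : b ≤ k) (hf : f a = f b) : h b ≤ h a := by
  classical
  induction b using Nat.strong_induction_on generalizing a with
  | _ b ih =>
    by_contra hlt
    push Not at hlt
    obtain ⟨c, hc, hmax⟩ := Finset.exists_max_image
      ((Finset.range b).filter fun a => 1 ≤ a ∧ f a = f b ∧ h a < h b) id
      ⟨a, by simp [hab, ha, hf, hlt]⟩
    simp only [Finset.mem_filter, Finset.mem_range, id] at hc hmax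
    obtain ⟨hcb, hc1, hcf, hch⟩ := hc
    obtain ⟨p, H, m, hJ, hp0, hpm, hH0, hdist⟩ := exists_jumpPath_nodup (V := V) (f := f)
      (h := h) (a := c) (b := b - 1) (by omega) (fun i _ hi => hr.step i (by omega))
    have hrange : ∀ t ≤ m, c ≤ p t ∧ p t ≤ b - 1 := fun t ht =>
      ⟨hp0 ▸ hJ.mono (Nat.zero_le t) ht, hpm ▸ hJ.mono ht le_rfl⟩
    have hheight : ∀ t ≤ m, (h (p t) : ℤ) - h c ≤ H t := by
      intro t ht
      have := hJ.height_le (h := h) (fun i hi hi' => hr.step i (by omega))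
        (fun a' b' h1 h2 h3 h4 => ih b' (by omega) (by omega) h2 (by omega) h4) ht
      rwa [hp0, hH0, sub_zero] at this
    have hfpm : f (p m) = f (b - 1) := by rw [hpm]
    obtain ⟨g, hg⟩ : ∃ g : ℕ → Q, g = fun t => if t ≤ m then f (p t) else f b := ⟨_, rfl⟩
    have hgle : ∀ t ≤ m, g t = f (p t) := fun t ht => by simp [hg, ht]
    have hgm : g (m + 1) = f b := by simp [hg]
    have hpw : ∀ t ≤ m, partialWeight V g t = H t := by
      intro t ht
      have h1 := hJ.partialWeight_eq ht
      rw [hH0, sub_zero] at h1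
      rw [← h1]
      refine Finset.sum_congr rfl fun i hi => ?_
      rw [Finset.mem_range] at hi
      rw [hgle i (by omega), hgle (i + 1) (by omega)]
    have hpw' : (h b : ℤ) - h c ≤ partialWeight V g (m + 1) := by
      have h1 := hr.step (b - 1) (by omega)
      rw [Nat.sub_add_cancel (by omega)] at h1
      have h2 := hheight m le_rfl
      rw [hpm] at h2
      rw [partialWeight_succ, hpw m le_rfl, hgm, hgle m le_rfl, hfpm]
      linarith
    have hsimple : IsSimpleCycleOn V (pathList g (m + 1)) (f c) := by
      refine ⟨⟨(isPath_pathList V g _).mpr fun i hi => ?_, by simp, ?_, ?_⟩, ?_⟩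
      · have h1 := hr.delta (p i) (by have := hrange i (by omega); omega)
        rw [hgle i (by omega)]
        rcases Nat.lt_succ_iff_lt_or_eq.mp hi with hi | rfl
        · rwa [hgle (i + 1) (by omega), ← hJ.state i hi]
        · rw [hgm]
          rw [hpm, Nat.sub_add_cancel (by omega)] at h1
          rwa [hpm]
      · rw [head?_pathList, hgle 0 (by omega), hp0]
      · rw [getLast?_pathList, hgm, hcf]
      · rw [pathList_succ_eq_append, List.dropLast_concat]
        refine nodup_pathList fun i j hij hj => ?_
        rw [hgle i (by omega), hgle j hj]
        rcases Nat.eq_zero_or_pos i with rfl | hi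
        · intro heq
          rw [hp0] at heq
          have h1 := hJ.add_le (Nat.zero_le j) hj
          have h2 := hrange j hj
          have h3 := ih (p j) (by omega) hc1 (by omega) (by omega) heq
          have h4 := hmax (p j) ⟨by omega, by omega, by rw [← heq, hcf], by omega⟩
          omega
        · exact hdist i j hi hij hj
    have hpos : 0 < pathWeight V (pathList g (m + 1)) := by
      rw [pathWeight_pathList]
      omega
    have hq : f c ∈ Qplus V := ⟨_, hsimple, hpos⟩
    have hmin : -(h c : ℤ) ≤ pmin V (pathList g (m + 1)) := by
      rw [le_pmin_pathList_iff]
      intro i hi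
      rcases hi.lt_or_eq with hi | rfl
      · rw [hpw i (by omega)]
        have := hheight i (by omega)
        omega
      · omega
    have := (hγ _ hq).2.2 _ hsimple hpos
    exact hconf c hc1 (by omega) ⟨hq, by simp only; omega⟩

end Jump

/-! ### Shortest runs into `U n` -/

/-- A run into `U n` of minimal length among the runs from `Conf₊ \ U n`. -/
structure IsMinRun (V : OneVASS Q) (γ : Q → List Q) (n : ℕ) (f : ℕ → Q) (h : ℕ → ℕ) (k : ℕ) :
    Prop where
  run : SeqRun V f h k
  start : (f 0, h 0) ∈ ConfPlus V γ \ U V γ n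
  target : (f k, h k) ∈ U V γ n
  minimal : ∀ c ∈ ConfPlus V γ \ U V γ n, ∀ j, RunLenTo V c (U V γ n) j → k ≤ j

section MinRun

variable {V : OneVASS Q} {γ : Q → List Q} {n k : ℕ} {f : ℕ → Q} {h : ℕ → ℕ}

lemma exists_isMinRun {q : Q} {z : ℕ} (hz : (q, z) ∈ Uprime V γ (U V γ n)) :
    ∃ f h k, IsMinRun V γ n f h k ∧ f 0 = q ∧ h 0 = z := by
  obtain ⟨hz, k, hk, hmin⟩ := hz
  obtain ⟨f, h, hr, rfl, rfl, ht⟩ := (runLenTo_iff V _ _ k).mp hk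
  exact ⟨f, h, k, ⟨hr, hz, ht, hmin⟩, rfl, rfl⟩

lemma IsMinRun.notMem_confPlus (hR : IsMinRun V γ n f h k) {i : ℕ} (hi : 1 ≤ i) (hik : i < k) :
    (f i, h i) ∉ ConfPlus V γ := by
  intro hc
  by_cases hU : (f i, h i) ∈ U V γ n
  · have := hR.minimal _ hR.start i ((runLenTo_iff V _ _ i).mpr ⟨f, h,
      ⟨fun j hj => hR.run.delta j (by omega), fun j hj => hR.run.step j (by omega),
        fun j hj => hR.run.valid j (by omega)⟩, rfl, rfl, hU⟩)
    omega
  · have := hR.minimal _ ⟨hc, hU⟩ (k - i) ((runLenTo_iff V _ _ _).mpr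
      ⟨fun j => f (j + i), fun j => h (j + i),
      ⟨fun j hj => ?_, fun j hj => ?_, fun j hj => hR.run.valid _ (by omega)⟩,
      by simp, by simp, ?_⟩)
    · omega
    · rw [Nat.add_right_comm]
      exact hR.run.delta _ (by omega)
    · rw [Nat.add_right_comm]
      exact hR.run.step _ (by omega)
    · simp only [Nat.sub_add_cancel hik.le]
      exact hR.target

/-- Apart from few exceptional starting values, a jump path along a shortest run into `U n` leads
from the complement of `U (n + 1)` to the complement of `U n`. -/
lemma IsMinRun.exists_exceptional (hγ : GammaChoice V γ) {g : Q → ℕ}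
    (hg : ∀ q z, z ≠ g q → z ∈ V.D q) (hR : IsMinRun V γ n f h k) {p : ℕ → ℕ} {H : ℕ → ℤ} {m : ℕ}
    (hJ : JumpPath V f p H m) (hp0 : p 0 = 0) (hpm : p m = k) (hH0 : H 0 = 0) :
    ∃ E : Finset ℕ, E.card ≤ m + 1 ∧ ∀ y ∉ E, h 0 ≤ y → (f 0, y) ∉ U V γ (n + 1) →
      (h k : ℤ) ≤ y + H m ∧ (f k, (y + H m).toNat) ∈ ConfPlus V γ \ U V γ n := by
  classical
  refine ⟨(Finset.range (m + 1)).image fun t => ((g (f (p t)) : ℤ) - H t).toNat,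
    Finset.card_image_le.trans (by simp), fun y hy h0y hyU => ?_⟩
  have hheight : ∀ t ≤ m, (h (p t) : ℤ) ≤ y + H t := by
    intro t ht
    have := hJ.height_le (h := h) (fun i _ hi => hR.run.step i (by omega))
      (fun a b h1 h2 h3 h4 => hR.run.le_of_state_eq hγ (fun i hi hik => hR.notMem_confPlus hi hik)
        (by omega) h2 (by omega) h4) ht
    rw [hp0, hH0] at this
    omega
  have hk := hheight m le_rfl
  rw [hpm] at hk
  have hconf : (f k, (y + H m).toNat) ∈ ConfPlus V γ :=
    confPlus_mono (U_subset_confPlus hγ n hR.target) (by omega)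
  refine ⟨hk, hconf, fun hU => hyU (Uprime_subset_succ n
    ⟨⟨confPlus_mono hR.start.1 h0y, fun hyn => hyU (U_subset_succ n hyn)⟩, m, ?_, ?_⟩)⟩
  · refine (runLenTo_iff V _ _ m).mpr ⟨fun t => f (p t), fun t => (y + H t).toNat,
      ⟨fun t ht => ?_, fun t ht => ?_, fun t ht => hg _ _ fun heq => hy ?_⟩,
      by simp [hp0], by simp [hH0], by simpa [hpm] using hU⟩
    · rw [← hJ.state t ht]
      refine hR.run.delta _ ?_
      have := hJ.lt t ht
      have := hJ.mono (s := t + 1) ht le_rfl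
      omega
    · have h1 := hheight t ht.le
      have h2 := hheight (t + 1) ht
      rw [Int.toNat_of_nonneg (by omega), Int.toNat_of_nonneg (by omega), hJ.step t ht]
      ring
    · have h1 := hheight t ht
      exact Finset.mem_image.mpr ⟨t, Finset.mem_range.mpr (by omega), by omega⟩
  · intro c hc j hj
    have h1 := hR.minimal c hc j hj
    have h2 := hJ.add_le (Nat.zero_le m) le_rfl
    omega

/-- Either a shortest run into `U n` can be replaced by a short run of the same weight modulo the
target cycle, or all but few configurations above its start belong to `U (n + 1)`. -/
lemma IsMinRun.short_or_few [Fintype Q] (hγ : GammaChoice V γ) (hg : SingleGuard V) {N : ℕ}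
    {B : Q → Finset ℕ} (hB : IsBlocking V γ N B) (hR : IsMinRun V γ n f h k) :
    (∃ (D : ℤ) (E : Finset ℕ), E.card ≤ N * Fintype.card Q + 1 ∧
      (Wnat V γ (f k) : ℤ) ∣ D - (h k - h 0) ∧
      ∀ y ∉ E, h 0 ≤ y → (f 0, y) ∉ U V γ (n + 1) →
        (h k : ℤ) ≤ y + D ∧ (f k, (y + D).toNat) ∈ ConfPlus V γ \ U V γ n) ∨
    ∃ E : Finset ℕ,
      E.card ≤ (N * Fintype.card Q + 1) * (N * Fintype.card Q + 1 + Fintype.card Q + 1) ∧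
      ∀ y, h 0 ≤ y → (f 0, y) ∉ U V γ (n + 1) → y ∈ E := by
  classical
  obtain ⟨g, hg⟩ := hg.exists_guard
  have hstep : ∀ a, ∀ i, a ≤ i → i < k → (h (i + 1) : ℤ) = h i + V.w (f i) (f (i + 1)) :=
    fun _ i _ hi => hR.run.step i hi
  obtain ⟨p, H, m, hJ, hp0, hpm, hH0, hdvd, hdist⟩ :=
    exists_jumpPath (Nat.zero_le k) (hstep 0) (Wnat V γ (f k))
  rcases le_or_gt m (N * Fintype.card Q) with hm | hm
  · obtain ⟨E, hE, hland⟩ := hR.exists_exceptional hγ hg hJ hp0 hpm hH0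
    exact Or.inl ⟨H m, E, by omega, hdvd, hland⟩
  right
  obtain ⟨s, -, hs⟩ := Finset.exists_lt_card_fiber_of_mul_lt_card_of_maps_to
    (s := Finset.Icc 1 (N * Fintype.card Q + 1)) (t := Finset.univ) (f := fun t => f (p t))
    (n := N) (fun _ _ => Finset.mem_univ _) (by rw [Finset.card_univ, Nat.card_Icc, mul_comm]; omega)
  set I := (Finset.Icc 1 (N * Fintype.card Q + 1)).filter fun t => f (p t) = s with hI
  have hmemI : ∀ t ∈ I, 1 ≤ t ∧ t ≤ N * Fintype.card Q + 1 ∧ f (p t) = s := by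
    intro t ht
    simpa [hI, and_assoc] using ht
  obtain ⟨T, hT, hmax⟩ := Finset.exists_max_image I id (Finset.card_pos.mp (by omega))
  obtain ⟨hT1, hT2, hT3⟩ := hmemI T hT
  obtain ⟨p', H', m', hJ', hp0', hpm', hH0', hdist'⟩ :=
    exists_jumpPath_nodup (hpm ▸ hJ.mono (s := T) (by omega) le_rfl) (hstep (p T))
  have hm' : m' ≤ Fintype.card Q := by
    have := Finset.card_le_card_of_injOn (s := Finset.Icc 1 m') (t := Finset.univ)
      (fun t => f (p' t)) (fun _ _ => Finset.mem_coe.mpr (Finset.mem_univ _)) ?_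
    · simpa using this
    intro i hi j hj hij
    rw [Finset.coe_Icc, Set.mem_Icc] at hi hj
    rcases lt_trichotomy i j with hlt | heq | hlt
    · exact absurd hij (hdist' i j hi.1 hlt hj.2)
    · exact heq
    · exact absurd hij.symm (hdist' j i hj.1 hlt hi.2)
  have hE : ∀ t, ∃ E : Finset ℕ, t ∈ I → E.card ≤ N * Fintype.card Q + 1 + Fintype.card Q + 1 ∧
      ∀ y ∉ E, h 0 ≤ y → (f 0, y) ∉ U V γ (n + 1) →
        (h k : ℤ) ≤ y + (H' m' + H t) ∧
        (f k, (y + (H' m' + H t)).toNat) ∈ ConfPlus V γ \ U V γ n := by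
    intro t
    by_cases ht : t ∈ I
    swap
    · exact ⟨∅, fun h => absurd h ht⟩
    obtain ⟨ht1, ht2, ht3⟩ := hmemI t ht
    have htT : t ≤ T := hmax t ht
    obtain ⟨E, hE, hland⟩ := hR.exists_exceptional hγ hg
      (hJ.join hJ' (i := t) (by omega) (by rw [hp0', ht3, hT3])
        (by rw [hp0']; exact hJ.mono htT (by omega)))
      (by simp [hp0, (by omega : 0 < t)]) (by simp [hpm']) (by simp [hH0, (by omega : 0 < t)])
    refine ⟨E, fun _ => ⟨by omega, ?_⟩⟩
    simpa [hH0'] using hland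
  choose E hE using hE
  refine ⟨I.biUnion E, ?_, fun y hy hyU => ?_⟩
  · refine (Finset.card_biUnion_le_card_mul I E _ fun t ht => (hE t ht).1).trans ?_
    refine Nat.mul_le_mul_right _ ((Finset.card_filter_le _ _).trans ?_)
    simp
  by_contra hnot
  have hland : ∀ t ∈ I, (h k : ℤ) ≤ y + (H' m' + H t) ∧
      (f k, (y + (H' m' + H t)).toNat) ∈ ConfPlus V γ \ U V γ n := fun t ht =>
    (hE t ht).2 y (fun h => hnot (Finset.mem_biUnion.mpr ⟨t, ht, h⟩)) hy hyU
  have hcard := card_le_of_residues hγ hB (U_subset_confPlus hγ n hR.target).1 I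
    (fun t => (y + (H' m' + H t)).toNat) (fun t ht => (hland t ht).2) ?_
  · omega
  intro i hi j hj hij
  have hdiv : (Wnat V γ (f k) : ℤ) ∣ H i - H j := by
    have h1 := (Int.natCast_modEq_iff.mpr hij : _ ≡ _ [ZMOD _]).symm.dvd
    rw [Int.toNat_of_nonneg (by have := (hland i hi).1; omega),
      Int.toNat_of_nonneg (by have := (hland j hj).1; omega)] at h1
    simpa using h1
  obtain ⟨hi1, hi2, hi3⟩ := hmemI i hi
  obtain ⟨hj1, hj2, hj3⟩ := hmemI j hj
  rcases lt_trichotomy i j with hlt | heq | hlt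
  · exact absurd hdiv (hdist i j hi1 hlt (by omega) (by rw [hi3, hj3]))
  · exact heq
  · exact absurd (dvd_sub_comm.mp hdiv) (hdist j i hj1 hlt (by omega) (by rw [hi3, hj3]))

end MinRun

/-! ### Gaps of active residue classes -/

/-- Counter values outside `U n` that lie between two consecutive values outside `U n` of the
residue class of `r`, above an element of `U n` in this class. -/
def activeGap (V : OneVASS Q) (γ : Q → List Q) (n : ℕ) (q : Q) (r : ℕ) : Set ℕ :=
  {y | (q, y) ∉ U V γ n ∧ ∃ x u, x ≤ y ∧ y < x + Wnat V γ q ∧ x ≡ r [MOD Wnat V γ q] ∧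
    (q, x) ∉ U V γ n ∧ (q, x + Wnat V γ q) ∉ U V γ n ∧
    (q, u) ∈ U V γ n ∧ u ≤ x ∧ u ≡ x [MOD Wnat V γ q]}

lemma exists_last_before {P : ℕ → Prop} {L : ℕ} (h0 : P 0) (hL : ¬ P L) :
    ∃ l < L, P l ∧ ¬ P (l + 1) := by
  by_contra! H
  have : ∀ l ≤ L, P l := by
    intro l
    induction l with
    | zero => exact fun _ => h0
    | succ l ih => exact fun hl => H l (by omega) (ih (by omega))
  exact hL (this L le_rfl)

section Gaps

variable {V : OneVASS Q} {γ : Q → List Q} {q q' : Q} {N n : ℕ} {B : Q → Finset ℕ}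

lemma activeGap_zero (hγ : GammaChoice V γ) (q : Q) (r : ℕ) : activeGap V γ 0 q r = ∅ := by
  refine Set.eq_empty_of_forall_notMem ?_
  rintro y ⟨-, x, u, -, -, -, hx, -, hu, hux, hmod⟩
  rw [mem_U_zero_iff hγ] at hu hx
  refine hx ⟨confPlus_mono hu.1 hux, fun j => ?_⟩
  obtain ⟨a, ha⟩ := (Nat.modEq_iff_dvd' hux).mp hmod
  have := hu.2 (a + j)
  rwa [add_mul, ← add_assoc, (by rw [mul_comm]; omega : u + a * Wnat V γ q = x)] at this

lemma mem_blocked_of_add_mem_U (hγ : GammaChoice V γ) (hB : IsBlocking V γ N B) {x : ℕ}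
    (hx : (q, x) ∈ ConfPlus V γ \ U V γ n) (hU : (q, x + Wnat V γ q) ∈ U V γ n) : x ∈ B q := by
  refine hB.mem q x hx.1 fun ht => hx.2 (U_of_linked hγ hx.1 ⟨1, by simp, fun i hi => ?_⟩ hU)
  obtain rfl : i = 0 := by omega
  simpa using ht

/-- Values outside `U n` in bounded windows around the points of a set `S` are few. -/
lemma card_le_of_near (hγ : GammaChoice V γ) (hB : IsBlocking V γ N B) (hq : q ∈ Qplus V)
    (F : Finset ℕ) (φ : ℕ → ℕ) (hφ : Set.InjOn φ F)
    (hF : ∀ y ∈ F, (q, φ y) ∈ ConfPlus V γ \ U V γ n) (S : Finset ℕ) (P : ℕ) (t : ℕ → ℤ)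
    (hS : ∀ y ∈ F, ∃ s ∈ S, t s ≤ φ y ∧ (φ y : ℤ) < t s + P * Wnat V γ q) :
    F.card ≤ S.card * (P * N) := by
  classical
  choose! s hs using hS
  have := Finset.card_le_mul_card_image_of_maps_to (s := F) (t := S) (f := s) (n := P * N)
    (fun y hy => (hs y hy).1) fun b _ => ?_
  · rwa [mul_comm] at this
  rw [← Finset.card_image_of_injOn (hφ.mono
    (Finset.coe_subset.mpr (Finset.filter_subset (fun y => s y = b) F)))]
  refine card_le_of_mem_window hγ hB hq (n := n) _ P (t b) ?_ ?_
  all_goals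
    intro w hw
    obtain ⟨y, hy, rfl⟩ := Finset.mem_image.mp hw
    obtain ⟨hyF, hyb⟩ := Finset.mem_filter.mp hy
  · exact hF y hyF
  · exact hyb ▸ (hs y hyF).2

/-- Two landing configurations in the same residue class yield one in the class of the target. -/
lemma exists_shift_modEq {N W W' a : ℕ} {D : ℤ} {z z' : ℕ} (hD : (W' : ℤ) ∣ D - (z' - z))
    {i j : ℕ} (hi : 1 ≤ i) (hij : i < j) (hj : j ≤ N + 1)
    (hdvd : (W' : ℤ) ∣ (j - i : ℤ) * W) :
    ∃ l, 1 ≤ l ∧ l ≤ N ∧ (W' : ℤ) ∣ (z + a * W + l * W + D) - z' := by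
  obtain ⟨d, rfl⟩ := Nat.exists_eq_add_of_lt hij
  have hmod : a % (d + 1) < d + 1 := Nat.mod_lt _ (by omega)
  refine ⟨d + 1 - a % (d + 1), by omega, by omega, ?_⟩
  have h1 := Nat.mod_add_div a (d + 1)
  have h2 : (a : ℤ) + ((d + 1 - a % (d + 1) : ℕ) : ℤ) = (d + 1) * (a / (d + 1) + 1 : ℕ) := by
    have : a + (d + 1 - a % (d + 1)) = (d + 1) * (a / (d + 1) + 1) := by
      rw [mul_add, mul_one]
      omega
    exact_mod_cast this
  have h3 : (W' : ℤ) ∣ (d + 1 : ℤ) * W := by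
    have : ((i + d + 1 : ℕ) : ℤ) - i = d + 1 := by push_cast; ring
    rwa [this] at hdvd
  have h4 := dvd_add (h3.mul_left ((a / (d + 1) + 1 : ℕ) : ℤ)) hD
  have h5 : (z + a * W + ((d + 1 - a % (d + 1) : ℕ) : ℤ) * W + D) - z' =
      ((a / (d + 1) + 1 : ℕ) : ℤ) * ((d + 1 : ℤ) * W) + (D - (z' - z)) := by
    linear_combination (W : ℤ) * h2
  rwa [h5]

/-- If most configurations at `q` above `z` and outside `U (n + 1)` land outside `U n` at `q'` when
shifted by `D`, then the gaps at `q` can be bounded by those at `q'`. -/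
lemma card_le_of_landing (hγ : GammaChoice V γ) (hB : IsBlocking V γ N B) {z z' : ℕ}
    (hz : (q, z) ∈ ConfPlus V γ) (hz' : (q', z') ∈ U V γ n) {D : ℤ} {E : Finset ℕ}
    (hD : (Wnat V γ q' : ℤ) ∣ D - (z' - z))
    (hland : ∀ y ∉ E, z ≤ y → (q, y) ∉ U V γ (n + 1) →
      (z' : ℤ) ≤ y + D ∧ (q', (y + D).toNat) ∈ ConfPlus V γ \ U V γ n)
    {b : ℕ} (hb : ∀ F : Finset ℕ, (∀ y ∈ F, y ∈ activeGap V γ n q' z') → F.card ≤ b)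
    (F : Finset ℕ)
    (hF : ∀ y ∈ F, (q, y) ∉ U V γ (n + 1) ∧ ∃ x, x ≤ y ∧ y < x + Wnat V γ q ∧ z ≤ x ∧
      x ≡ z [MOD Wnat V γ q] ∧ (q, x) ∉ U V γ (n + 1)) :
    F.card ≤ b + (E.card + (N + E.card) * ((N + 2) * N) + N * (1 * N) + N * ((N + 1) * N)) := by
  classical
  have hq : q ∈ Qplus V := hz.1
  have hz'c := U_subset_confPlus hγ n hz'
  have hq' : q' ∈ Qplus V := hz'c.1
  have hW := Wnat_pos hγ hq
  have hW' := Wnat_pos hγ hq'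
  set W := Wnat V γ q with hWdef
  set W' := Wnat V γ q' with hW'def
  choose! hFU x hx1 hx2 hx3 hx4 hx5 using hF
  -- `y` lies close to a blocked or exceptional value
  set F₂ := F.filter fun y => ∃ i ≤ N + 1, x y + i * W ∈ B q ∪ E
  -- the landing point of `y` and the value of the target class below it
  set φ : ℕ → ℕ := fun y => (y + D).toNat
  set ξ : ℕ → ℕ := fun y => φ y - (φ y - z') % W'
  set F₃ := F.filter fun y => y ∉ E ∧ ∀ i ≤ N + 1, x y + i * W ∉ B q ∪ E
  have hcover : F ⊆ E ∪ F₂ ∪ F₃ := by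
    intro y hy
    by_cases h1 : y ∈ E
    · simp [h1]
    by_cases h2 : ∃ i ≤ N + 1, x y + i * W ∈ B q ∪ E
    · exact Finset.mem_union_left _ (Finset.mem_union_right _ (Finset.mem_filter.mpr ⟨hy, h2⟩))
    · push Not at h2
      exact Finset.mem_union_right _ (Finset.mem_filter.mpr ⟨hy, h1, h2⟩)
  have hcard₂ : F₂.card ≤ (N + E.card) * ((N + 2) * N) := by
    refine (card_le_of_near hγ hB hq (n := n + 1) F₂ id Function.injective_id.injOn ?_ (B q ∪ E)
      (N + 2) (fun s => s - (N + 1) * W) ?_).trans (Nat.mul_le_mul_right _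
        ((Finset.card_union_le _ _).trans (Nat.add_le_add_right (hB.card_le q hq) _)))
    · intro y hy
      have hyF := (Finset.mem_filter.mp hy).1
      exact ⟨confPlus_mono hz ((hx3 y hyF).trans (hx1 y hyF)), hFU y hyF⟩
    · intro y hy
      obtain ⟨hyF, i, hi, hmem⟩ := Finset.mem_filter.mp hy
      refine ⟨_, hmem, ?_⟩
      have h1 := hx1 y hyF
      have h2 := hx2 y hyF
      have h3 : i * W ≤ (N + 1) * W := Nat.mul_le_mul_right _ hi
      simp only [id]
      zify at h1 h2 h3
      push_cast
      constructor
      · linarith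
      · have : (0 : ℤ) ≤ i * W := by positivity
        linarith
  have hF₃U : ∀ y ∈ F₃, ∀ i ≤ N + 1, (q, x y + i * W) ∉ U V γ (n + 1) := by
    intro y hy i
    obtain ⟨hyF, -, hy2⟩ := Finset.mem_filter.mp hy
    induction i with
    | zero => simpa using hx5 y hyF
    | succ i ih =>
      intro hi hU
      refine hy2 i (by omega) (Finset.mem_union_left _ (mem_blocked_of_add_mem_U hγ hB
        ⟨confPlus_mono hz ((hx3 y hyF).trans (by omega)), ih (by omega)⟩ ?_))
      rw [← hWdef]
      convert hU using 2
      ring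
  have hF₃land : ∀ y ∈ F₃, (z' : ℤ) ≤ y + D ∧ (q', φ y) ∈ ConfPlus V γ \ U V γ n := by
    intro y hy
    obtain ⟨hyF, hyE, -⟩ := Finset.mem_filter.mp hy
    exact hland y hyE ((hx3 y hyF).trans (hx1 y hyF)) (hFU y hyF)
  have hφcast : ∀ y ∈ F₃, (φ y : ℤ) = y + D := fun y hy =>
    Int.toNat_of_nonneg (by have := (hF₃land y hy).1; omega)
  have hξ1 : ∀ y ∈ F₃, z' ≤ ξ y ∧ ξ y ≤ φ y ∧ φ y < ξ y + W' ∧ z' ≡ ξ y [MOD W'] := by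
    intro y hy
    have h0 : ξ y = φ y - (φ y - z') % W' := rfl
    have h1 := hφcast y hy
    have h2 := (hF₃land y hy).1
    have h3 := Nat.mod_lt (φ y - z') hW'
    have h4 := Nat.mod_le (φ y - z') W'
    have h5 := Nat.mod_add_div (φ y - z') W'
    refine ⟨by omega, by omega, by omega, (Nat.modEq_iff_dvd' (by omega)).mpr
      ⟨(φ y - z') / W', by omega⟩⟩
  have hφinj : Set.InjOn φ F₃ := by
    intro y hy y' hy' heq
    have h1 := hφcast y hy
    have h2 := hφcast y' hy'
    rw [heq] at h1
    omega
  set F₄ := F₃.filter fun y => (q', ξ y) ∉ U V γ n ∧ (q', ξ y + W') ∉ U V γ n with hF₄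
  set F₅ := F₃.filter fun y => (q', ξ y) ∉ U V γ n ∧ (q', ξ y + W') ∈ U V γ n with hF₅
  set F₆ := F₃.filter fun y => (q', ξ y) ∈ U V γ n with hF₆
  have hcover₃ : F₃ ⊆ F₄ ∪ F₅ ∪ F₆ := by
    intro y hy
    simp only [hF₄, hF₅, hF₆, Finset.mem_union, Finset.mem_filter, hy, true_and]
    tauto
  have hsub₄ : F₄ ⊆ F₃ := Finset.filter_subset _ _
  have hsub₅ : F₅ ⊆ F₃ := Finset.filter_subset _ _
  have hsub₆ : F₆ ⊆ F₃ := Finset.filter_subset _ _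
  have hcard₄ : F₄.card ≤ b := by
    rw [← Finset.card_image_of_injOn (hφinj.mono (Finset.coe_subset.mpr hsub₄))]
    refine hb _ fun w hw => ?_
    obtain ⟨y, hy, rfl⟩ := Finset.mem_image.mp hw
    obtain ⟨hy3, h1, h2⟩ := Finset.mem_filter.mp hy
    obtain ⟨h3, h4, h5, h6⟩ := hξ1 y hy3
    exact ⟨(hF₃land y hy3).2.2, ξ y, z', h4, h5, h6.symm, h1, h2, hz', h3, h6⟩
  have hcard₅ : F₅.card ≤ N * (1 * N) := by
    refine (card_le_of_near hγ hB hq' F₅ φ (hφinj.mono (Finset.coe_subset.mpr hsub₅))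
      (fun y hy => (hF₃land y (hsub₅ hy)).2) (B q') 1 (fun s => s) ?_).trans
      (Nat.mul_le_mul_right _ (hB.card_le q' hq'))
    intro y hy
    obtain ⟨hy3, h1, h2⟩ := Finset.mem_filter.mp hy
    obtain ⟨h3, h4, h5, h6⟩ := hξ1 y hy3
    refine ⟨ξ y, mem_blocked_of_add_mem_U hγ hB ⟨confPlus_mono hz'c h3, h1⟩ h2, ?_⟩
    rw [← hW'def]
    constructor
    · exact_mod_cast h4
    · push_cast
      rw [one_mul]
      exact_mod_cast h5
  have hentry : ∀ y ∈ F₆, ∃ s, ((q', s) ∈ U V γ n ∧ (q', s + W') ∉ U V γ n) ∧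
      φ y < s + W' ∧ (s + W' : ℤ) ≤ φ y + (N + 1) * W := by
    intro y hy
    obtain ⟨hy3, hyU⟩ := Finset.mem_filter.mp hy
    obtain ⟨hyF, -, hyBE⟩ := Finset.mem_filter.mp hy3
    obtain ⟨h3, h4, h5, h6⟩ := hξ1 y hy3
    have hland' : ∀ i ≤ N + 1, (z' : ℤ) ≤ (x y + i * W : ℕ) + D ∧
        (q', ((x y + i * W : ℕ) + D).toNat) ∈ ConfPlus V γ \ U V γ n := fun i hi =>
      hland _ (fun h => hyBE i hi (Finset.mem_union_right _ h))
        ((hx3 y hyF).trans (Nat.le_add_right _ _)) (hF₃U y hy3 i hi)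
    obtain ⟨a, ha⟩ := (Nat.modEq_iff_dvd' (hx3 y hyF)).mp (hx4 y hyF).symm
    have hxa : x y = z + a * W := by
      have := hx3 y hyF
      rw [mul_comm] at ha
      omega
    obtain ⟨i, j, hi, hij, hj, hdvd⟩ : ∃ i j : ℕ, 1 ≤ i ∧ i < j ∧ j ≤ N + 1 ∧
        (W' : ℤ) ∣ (j - i : ℤ) * W := by
      by_contra! H
      have := card_le_of_residues hγ hB hq' (Finset.Icc 1 (N + 1))
        (fun i => ((x y + i * W : ℕ) + D).toNat)
        (fun i hi => (hland' i (Finset.mem_Icc.mp hi).2).2) ?_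
      · simp at this
      have key : ∀ i ≤ N + 1, ∀ j ≤ N + 1, ((x y + i * W : ℕ) + D).toNat % W' =
          ((x y + j * W : ℕ) + D).toNat % W' → (W' : ℤ) ∣ (j - i : ℤ) * W := by
        intro i hi j hj hij
        have h1 := (Int.natCast_modEq_iff.mpr hij : _ ≡ _ [ZMOD _]).dvd
        rw [Int.toNat_of_nonneg (by have := (hland' j hj).1; omega),
          Int.toNat_of_nonneg (by have := (hland' i hi).1; omega)] at h1
        push_cast at h1
        convert h1 using 1
        ring
      intro i hi j hj hij
      rw [Finset.mem_Icc] at hi hj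
      rcases lt_trichotomy i j with hlt | heq | hlt
      · exact absurd (key i hi.2 j hj.2 hij) (H i j hi.1 hlt hj.2)
      · exact heq
      · exact absurd (key j hj.2 i hi.2 hij.symm) (H j i hj.1 hlt hi.2)
    obtain ⟨l, hl1, hl2, hl⟩ := exists_shift_modEq (a := a) hD hi hij hj hdvd
    have hlW : W ≤ l * W := Nat.le_mul_of_pos_left _ hl1
    have hlN : l * W ≤ (N + 1) * W := Nat.mul_le_mul_right _ (by omega)
    obtain ⟨hw1, hw2⟩ := hland' l (by omega)
    obtain ⟨w, hw⟩ : ∃ w, w = ((x y + l * W : ℕ) + D).toNat := ⟨_, rfl⟩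
    rw [← hw] at hw2
    have hwc : (w : ℤ) = x y + l * W + D := by
      rw [hw, Int.toNat_of_nonneg (by omega)]
      push_cast
      ring
    have hφy := hφcast y hy3
    have hyx := hx2 y hyF
    have hxy := hx1 y hyF
    have hφw : φ y < w := by
      zify at hlW hyx ⊢
      linarith
    have hmod : ξ y ≡ w [MOD W'] := by
      refine h6.symm.trans ?_
      rw [Nat.modEq_iff_dvd, hwc, hxa]
      push_cast
      exact hl
    obtain ⟨L, hL⟩ := (Nat.modEq_iff_dvd' (by omega)).mp hmod
    have hwL : w = ξ y + L * W' := by rw [mul_comm] at hL; omega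
    obtain ⟨t, htL, ht1, ht2⟩ := exists_last_before (P := fun t => (q', ξ y + t * W') ∈ U V γ n)
      (L := L) (by simpa using hyU) (by rw [← hwL]; exact hw2.2)
    have hassoc : ξ y + (t + 1) * W' = ξ y + t * W' + W' := by ring
    have hle : (t + 1) * W' ≤ L * W' := Nat.mul_le_mul_right _ htL
    rw [hassoc] at ht2
    refine ⟨ξ y + t * W', ⟨ht1, ht2⟩, by omega, ?_⟩
    have h7 : ξ y + t * W' + W' ≤ w := by omega
    zify at h7 hxy hlN
    push_cast
    linarith
  choose! s hs1 hs2 hs3 using hentry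
  have hcard₆ : F₆.card ≤ N * ((N + 1) * N) := by
    have hent : (F₆.image s).card ≤ N := by
      refine card_le_of_entries hγ hB hq' (n := n) _ fun e he => ?_
      obtain ⟨y, hy, rfl⟩ := Finset.mem_image.mp he
      exact hs1 y hy
    refine (card_le_of_near hγ hB hq (n := n + 1) F₆ id Function.injective_id.injOn ?_ (F₆.image s)
      (N + 1) (fun e => e + W' - D - (N + 1) * W) ?_).trans (Nat.mul_le_mul_right _ hent)
    · intro y hy
      have hyF := (Finset.mem_filter.mp (hsub₆ hy)).1
      exact ⟨confPlus_mono hz ((hx3 y hyF).trans (hx1 y hyF)), hFU y hyF⟩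
    · intro y hy
      refine ⟨s y, Finset.mem_image_of_mem _ hy, ?_⟩
      have h1 := hs2 y hy
      have h2 := hs3 y hy
      have h3 := hφcast y (hsub₆ hy)
      zify at h1
      simp only [id]
      push_cast
      constructor <;> linarith
  calc F.card ≤ (E ∪ F₂ ∪ (F₄ ∪ F₅ ∪ F₆)).card :=
        Finset.card_le_card (hcover.trans (Finset.union_subset_union_right hcover₃))
    _ ≤ E.card + F₂.card + (F₄.card + F₅.card + F₆.card) := by
        refine (Finset.card_union_le _ _).trans (Nat.add_le_add (Finset.card_union_le _ _) ?_)
        exact (Finset.card_union_le _ _).trans (Nat.add_le_add_right (Finset.card_union_le _ _) _)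
    _ ≤ _ := by omega

end Gaps

/-! ### Counting the steps -/

open Classical in
/-- The points of `B` lying above an element of `U n` in their residue class. -/
noncomputable def activePoints [Fintype Q] (V : OneVASS Q) (γ : Q → List Q) (B : Q → Finset ℕ)
    (n : ℕ) : Finset (Σ _ : Q, ℕ) :=
  ((Finset.univ.filter (· ∈ Qplus V)).sigma B).filter fun c =>
    ∃ v ≤ c.2, v ≡ c.2 [MOD Wnat V γ c.1] ∧ (c.1, v) ∈ U V γ n

/-- The growth of the gaps caused by the activation of a new point, for `c` states and at most `N`
blocked values per state. -/
def gapGrowth (N c : ℕ) : ℕ :=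
  (N * c + 1) + (N + (N * c + 1)) * ((N + 2) * N) + N * (1 * N) + N * ((N + 1) * N) +
    (N * c + 1) * (N * c + 1 + c + 1)

section Steps

variable [Fintype Q] {V : OneVASS Q} {γ : Q → List Q} {N : ℕ} {B : Q → Finset ℕ}

lemma mem_activePoints (hγ : GammaChoice V γ) {q : Q} {u n : ℕ} :
    (⟨q, u⟩ : Σ _ : Q, ℕ) ∈ activePoints V γ B n ↔
      u ∈ B q ∧ ∃ v ≤ u, v ≡ u [MOD Wnat V γ q] ∧ (q, v) ∈ U V γ n := by
  simp only [activePoints, Finset.mem_filter, Finset.mem_sigma, Finset.mem_univ, true_and]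
  constructor
  · rintro ⟨⟨-, h1⟩, h2⟩
    exact ⟨h1, h2⟩
  · rintro ⟨h1, v, h2, h3, h4⟩
    exact ⟨⟨(U_subset_confPlus hγ n h4).1, h1⟩, v, h2, h3, h4⟩

lemma activePoints_mono {m n : ℕ} (h : m ≤ n) : activePoints V γ B m ⊆ activePoints V γ B n := by
  intro c hc
  simp only [activePoints, Finset.mem_filter] at hc ⊢
  obtain ⟨h1, v, h2, h3, h4⟩ := hc
  exact ⟨h1, v, h2, h3, U_mono h h4⟩

lemma card_sigma_blocked_le (hB : IsBlocking V γ N B) [DecidablePred (· ∈ Qplus V)] :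
    ((Finset.univ.filter (· ∈ Qplus V)).sigma B).card ≤ Fintype.card Q * N := by
  rw [Finset.card_sigma]
  refine (Finset.sum_le_card_nsmul _ _ N fun q hq =>
    hB.card_le q (Finset.mem_filter.mp hq).2).trans ?_
  exact Nat.mul_le_mul_right _ (Finset.card_le_univ _)

lemma card_activePoints_le (hB : IsBlocking V γ N B) (n : ℕ) :
    (activePoints V γ B n).card ≤ Fintype.card Q * N := by
  classical
  exact (Finset.card_filter_le _ _).trans (card_sigma_blocked_le hB)

lemma activeGap_succ_subset (hγ : GammaChoice V γ) (hB : IsBlocking V γ N B) {n : ℕ}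
    (hA : activePoints V γ B (n + 1) = activePoints V γ B n) (q : Q) (r : ℕ) :
    activeGap V γ (n + 1) q r ⊆ activeGap V γ n q r := by
  rintro y ⟨hy, x, u, hxy, hyx, hxr, hx, hxW, hu, hux, hmod⟩
  have hconf : (q, x) ∈ ConfPlus V γ := confPlus_mono (U_subset_confPlus hγ _ hu) hux
  have hW := Wnat_pos hγ hconf.1
  obtain ⟨b, hb, hxb⟩ := exists_linked_blocked hγ hB ⟨hconf, hx⟩
  have hbA : (⟨q, b⟩ : Σ _ : Q, ℕ) ∈ activePoints V γ B (n + 1) :=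
    (mem_activePoints hγ).mpr ⟨hb, u, hux.trans hxb.le, hmod.trans hxb.mod_eq.symm, hu⟩
  rw [hA, mem_activePoints hγ] at hbA
  obtain ⟨-, v, hvb, hvmod, hv⟩ := hbA
  have hvx : v % Wnat V γ q = x % Wnat V γ q := hvmod.trans hxb.mod_eq
  refine ⟨fun h => hy (U_subset_succ n h), x, v, hxy, hyx, hxr, fun h => hx (U_subset_succ n h),
    fun h => hxW (U_subset_succ n h), hv, ?_, hvx⟩
  by_contra hlt
  exact hx (U_of_linked hγ hconf (hxb.between hW (by omega) hvb hvx) (U_subset_succ n hv))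

/-- Each residue class has few gaps, depending on the number of active points. -/
lemma card_le_of_activeGap (hγ : GammaChoice V γ) (hg : SingleGuard V) (hB : IsBlocking V γ N B)
    (n : ℕ) (q : Q) (r : ℕ) (F : Finset ℕ) (hF : ∀ y ∈ F, y ∈ activeGap V γ n q r) :
    F.card ≤ gapGrowth N (Fintype.card Q) * (activePoints V γ B n).card := by
  classical
  induction n generalizing q r F with
  | zero =>
    rw [Finset.eq_empty_of_forall_notMem (s := F) fun y hy => by
      have := hF y hy
      rwa [activeGap_zero hγ] at this]
    simp
  | succ n ih =>
    by_cases hA : activePoints V γ B (n + 1) = activePoints V γ B n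
    · rw [hA]
      exact ih q r F fun y hy => activeGap_succ_subset hγ hB hA q r (hF y hy)
    have hcard : (activePoints V γ B n).card + 1 ≤ (activePoints V γ B (n + 1)).card :=
      Finset.card_lt_card ((activePoints_mono (Nat.le_succ n)).ssubset_of_ne (Ne.symm hA))
    refine le_trans ?_ (Nat.mul_le_mul_left _ hcard)
    rw [mul_add, mul_one]
    by_cases hne : ∃ u, (q, u) ∈ U V γ (n + 1) ∧ u ≡ r [MOD Wnat V γ q]
    swap
    · rw [Finset.eq_empty_of_forall_notMem (s := F) fun y hy => ?_]
      · simp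
      obtain ⟨-, x, u, -, -, hxr, -, -, hu, -, hux⟩ := hF y hy
      exact hne ⟨u, hu, hux.trans hxr⟩
    -- the least element of the class and the configuration that put it into `U (n + 1)`
    obtain ⟨hbU, hbr⟩ := Nat.find_spec hne
    set b := Nat.find hne
    have hbc := U_subset_confPlus hγ _ hbU
    have hW := Wnat_pos hγ hbc.1
    obtain ⟨z, hbz, hz⟩ := exists_linked_of_mem_U_succ hγ hbU
    have hzr : z ≡ r [MOD Wnat V γ q] := Nat.ModEq.trans hbz.mod_eq hbr
    have hzU : (q, z) ∈ U V γ (n + 1) :=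
      hz.elim (fun h => U_subset_succ n h) fun h => Uprime_subset_succ n h
    have hzx : ∀ x u, (q, u) ∈ U V γ (n + 1) → u ≤ x → u ≡ x [MOD Wnat V γ q] →
        x ≡ r [MOD Wnat V γ q] → (q, x) ∉ U V γ (n + 1) → z ≤ x := by
      intro x u hu hux hmod hxr hx
      by_contra hlt
      have hbx : b ≤ x := (Nat.find_min' hne ⟨hu, hmod.trans hxr⟩).trans hux
      have h1 := hbz.between hW hbx (by omega) (hxr.trans hbr.symm)
      exact hx (U_of_linked hγ (confPlus_mono hbc hbx) (h1.of_left hW hbz (by omega)) hzU)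
    rcases hz with hz | hz
    · refine (ih q r F fun y hy => ?_).trans (Nat.le_add_right _ _)
      obtain ⟨hy, x, u, hxy, hyx, hxr, hx, hxW, hu, hux, hmod⟩ := hF y hy
      exact ⟨fun h => hy (U_subset_succ n h), x, z, hxy, hyx, hxr,
        fun h => hx (U_subset_succ n h), fun h => hxW (U_subset_succ n h), hz,
        hzx x u hu hux hmod hxr hx, hzr.trans hxr.symm⟩
    have hF' : ∀ y ∈ F, (q, y) ∉ U V γ (n + 1) ∧ ∃ x, x ≤ y ∧ y < x + Wnat V γ q ∧ z ≤ x ∧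
        x ≡ z [MOD Wnat V γ q] ∧ (q, x) ∉ U V γ (n + 1) := by
      intro y hy
      obtain ⟨hy, x, u, hxy, hyx, hxr, hx, -, hu, hux, hmod⟩ := hF y hy
      exact ⟨hy, x, hxy, hyx, hzx x u hu hux hmod hxr hx, hxr.trans hzr.symm, hx⟩
    obtain ⟨f, h, k, hR, rfl, rfl⟩ := exists_isMinRun hz
    rcases hR.short_or_few hγ hg hB with ⟨D, E, hE, hD, hland⟩ | ⟨E, hE, hfew⟩
    · refine (card_le_of_landing hγ hB hz.1.1 hR.target hD hland (ih _ _) F hF').trans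
        (Nat.add_le_add_left ?_ _)
      have := Nat.mul_le_mul_right ((N + 2) * N) (Nat.add_le_add_left hE N)
      rw [gapGrowth]
      omega
    · have hFE : F ⊆ E := fun y hy => by
        obtain ⟨hyU, x, hxy, -, hzx, -⟩ := hF' y hy
        exact hfew y (hzx.trans hxy) hyU
      refine ((Finset.card_le_card hFE).trans hE).trans (le_trans ?_ (Nat.le_add_left _ _))
      exact Nat.le_add_left _ _

/-- The number of steps at which the sequence `U` grows. -/
lemma growing_steps_le (hγ : GammaChoice V γ) (hg : SingleGuard V) (hB : IsBlocking V γ N B)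
    {M : ℕ} (hM : ∀ n < M, U V γ (n + 1) ≠ U V γ n) :
    M ≤ Fintype.card Q * N *
      (gapGrowth N (Fintype.card Q) * (Fintype.card Q * N) + 2) := by
  classical
  rcases Nat.eq_zero_or_pos M with rfl | hMpos
  · exact Nat.zero_le _
  have hex : ∀ n < M, ∃ (q : Q) (y u : ℕ), (q, y) ∈ Uprime V γ (U V γ n) ∧ u ∈ B q ∧
      Linked V γ q y u := by
    intro n hn
    obtain ⟨⟨q, y⟩, hy⟩ := Set.nonempty_iff_ne_empty.mpr fun h =>
      hM n hn (U_succ_eq_of_Uprime_eq_empty hγ h)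
    obtain ⟨u, hu, hyu⟩ := exists_linked_blocked hγ hB hy.1
    exact ⟨q, y, u, hy, hu, hyu⟩
  obtain ⟨q₀, -⟩ := hex 0 hMpos
  have : Nonempty Q := ⟨q₀⟩
  choose! q y u hy hu hyu using hex
  -- the configurations below the blocked one that are left outside of `U (n + 1)`
  set T : ℕ → Finset ℕ := fun n => (Finset.range (u n + 1)).filter fun x =>
    Linked V γ (q n) x (u n) ∧ (q n, x) ∈ ConfPlus V γ \ U V γ (n + 1) with hT
  have hmemT : ∀ n x, x ∈ T n ↔ Linked V γ (q n) x (u n) ∧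
      (q n, x) ∈ ConfPlus V γ \ U V γ (n + 1) := by
    intro n x
    simp only [hT, Finset.mem_filter, Finset.mem_range]
    exact ⟨fun h => h.2, fun h => ⟨by have := h.1.le; omega, h⟩⟩
  have hdecr : ∀ m n, m < n → n < M → q m = q n → u m = u n → (T n).card < (T m).card := by
    intro m n hmn hn hq hu'
    refine Finset.card_lt_card ⟨fun x hx => ?_, fun hsub => ?_⟩
    · rw [hmemT] at hx ⊢
      rw [hq, hu']
      exact ⟨hx.1, hx.2.1, fun h => hx.2.2 (U_mono (by omega) h)⟩
    · have hyT : y n ∈ T m := by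
        rw [hmemT, hq, hu']
        exact ⟨hyu n hn, (hy n hn).1.1, fun h => (hy n hn).1.2 (U_mono (by omega) h)⟩
      exact ((hmemT n _).mp (hsub hyT)).2.2 (Uprime_subset_succ n (hy n hn))
  have hcardT : ∀ n < M, (T n).card ≤
      gapGrowth N (Fintype.card Q) * (Fintype.card Q * N) + 1 := by
    intro n hn
    have hW : 0 < Wnat V γ (q n) := Wnat_pos hγ (hy n hn).1.1.1
    have hyU := Uprime_subset_succ n (hy n hn)
    have h := card_le_of_activeGap hγ hg hB (n + 1) (q n) (u n) ((T n).erase (u n)) ?_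
    · have h1 := Finset.pred_card_le_card_erase (s := T n) (a := u n)
      have h2 := Nat.mul_le_mul_left (gapGrowth N (Fintype.card Q))
        (card_activePoints_le (V := V) (γ := γ) hB (n + 1))
      omega
    intro x hx
    rw [Finset.mem_erase, hmemT] at hx
    obtain ⟨hxu, hlink, hxc, hxU⟩ := hx
    have hyx : y n ≤ x := by
      by_contra hlt
      exact hxU (U_of_linked hγ hxc (hlink.of_right hW (hyu n hn) (by omega)) hyU)
    have hstep : Linked V γ (q n) x (x + Wnat V γ (q n)) := by
      obtain ⟨j, hj, hj'⟩ := hlink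
      rcases j with _ | j
      · simp at hj
        omega
      · exact ⟨1, by simp, fun i hi => hj' i (by omega)⟩
    exact ⟨hxU, x, y n, le_rfl, by omega, hlink.mod_eq.symm, hxU,
      fun h => hxU (U_of_linked hγ hxc hstep h), hyU, hyx,
      (hyu n hn).mod_eq.symm.trans hlink.mod_eq⟩
  have hcard := Finset.card_le_card_of_injOn (s := Finset.range M)
    (t := ((Finset.univ.filter (· ∈ Qplus V)).sigma B) ×ˢ
      Finset.range (gapGrowth N (Fintype.card Q) * (Fintype.card Q * N) + 2))
    (fun n => ((⟨q n, u n⟩ : Σ _ : Q, ℕ), (T n).card)) ?_ ?_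
  · rw [Finset.card_range, Finset.card_product, Finset.card_range] at hcard
    exact hcard.trans (Nat.mul_le_mul_right _ (card_sigma_blocked_le hB))
  · intro n hn
    have hn : n < M := by simpa using hn
    have := hcardT n hn
    simp only [Finset.coe_product, Set.mem_prod, Finset.mem_coe, Finset.mem_sigma,
      Finset.mem_filter, Finset.mem_univ, true_and, Finset.mem_range]
    exact ⟨⟨(hy n hn).1.1.1, hu n hn⟩, by omega⟩
  · intro m hm n hn heq
    have hm : m < M := by simpa using hm
    have hn : n < M := by simpa using hn
    simp only [Prod.mk.injEq, Sigma.mk.injEq, heq_eq_eq] at heq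
    obtain ⟨⟨h1, h2⟩, h3⟩ := heq
    rcases lt_trichotomy m n with hlt | h | hlt
    · have := hdecr m n hlt hn h1 h2
      omega
    · exact h
    · have := hdecr n m hlt hm h1.symm h2.symm
      omega

end Steps

/-- Corollary 8: there is a polynomial `p` such that the sequence `(U_n)`
stabilizes within `p(|Q|)` steps. -/
theorem U_stabilizes_polynomially :
    ∃ p : Polynomial ℕ,
      ∀ (Q : Type) [Fintype Q] (V : OneVASS Q), SingleGuard V →
        ∀ γ : Q → List Q, GammaChoice V γ →
          ∀ n : ℕ, p.eval (Fintype.card Q) ≤ n →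
            U V γ n = U V γ (p.eval (Fintype.card Q)) := by
  obtain ⟨p, hp⟩ : ∃ p : Polynomial ℕ, ∀ c, p.eval c =
      c * (c + 1) * (gapGrowth (c + 1) c * (c * (c + 1)) + 2) := by
    refine ⟨let X := Polynomial.X; X * (X + 1) * ((((X + 1) * X + 1) + ((X + 1) + ((X + 1) * X + 1)) *
      (((X + 1) + 2) * (X + 1)) + (X + 1) * (1 * (X + 1)) + (X + 1) * (((X + 1) + 1) * (X + 1)) +
      ((X + 1) * X + 1) * ((X + 1) * X + 1 + X + 1)) * (X * (X + 1)) + 2), fun c => ?_⟩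
    simp [gapGrowth]
  refine ⟨p, fun Q _ V hg γ hγ n hn => ?_⟩
  obtain ⟨B, hB⟩ := exists_isBlocking hγ hg
  obtain ⟨m, hm, hstable⟩ : ∃ m ≤ p.eval (Fintype.card Q), U V γ (m + 1) = U V γ m := by
    by_contra! H
    have := growing_steps_le hγ hg hB (M := p.eval (Fintype.card Q) + 1)
      fun m hm => H m (Nat.lt_succ_iff.mp hm)
    rw [hp] at this
    omega
  rw [U_eq_of_succ_eq hstable (hm.trans hn), U_eq_of_succ_eq hstable hm]

end VASSPaper
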